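/- arXiv:1506.05546 — 3 statements merged into one kernel-verified Lean document; each statement's English description precedes it below -/
import Mathlib

section
/- Let (W,S) be a Coxeter system with Coxeter matrix M over an index set B. If ω and ω' are two reduced words (lists over B) whose products in W are equal, then ω' can be obtained from ω by a finite sequence of braid moves, where a braid move replaces a contiguous subword of the form alternatingWord i j (M i j) (the alternating word i, j, i, j, ... of length M i j) by alternatingWord j i (M i j), for indices i, j with M i j ≥ 2. Formally: the reflexive-transitive closure of the braid-move relation on lists relates ω and ω'. -/
/-- A *braid move* on words over the index set `B` of a Coxeter matrix `M`:
replace a contiguous subword `alternatingWord i j (M i j)` by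
`alternatingWord j i (M i j)`, for indices `i, j` with `M i j ≥ 2`. -/
def BraidMoveRel {B : Type*} (M : CoxeterMatrix B) (ω ω' : List B) : Prop :=
  ∃ (i j : B) (l₁ l₂ : List B), 2 ≤ M i j ∧
    ω = l₁ ++ CoxeterSystem.alternatingWord i j (M i j) ++ l₂ ∧
    ω' = l₁ ++ CoxeterSystem.alternatingWord j i (M i j) ++ l₂

namespace CoxeterMatrix

variable {B : Type*} (M : CoxeterMatrix B)

/-- The linear form `2⟨eᵢ, ·⟩` of the geometric representation. -/
noncomputable def rootForm (i : B) : Module.Dual ℝ (B →₀ ℝ) :=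
  Finsupp.linearCombination ℝ fun j ↦ -2 * Real.cos (Real.pi / M i j)

theorem rootForm_single (i j : B) :
    M.rootForm i (Finsupp.single j 1) = -2 * Real.cos (Real.pi / M i j) := by
  simp [rootForm]

theorem rootForm_single_self (i : B) : M.rootForm i (Finsupp.single i 1) = 2 := by
  simp [rootForm_single]

/-- The simple reflections of the geometric representation. -/
noncomputable def rootReflection (i : B) : (B →₀ ℝ) ≃ₗ[ℝ] (B →₀ ℝ) :=
  Module.reflection (M.rootForm_single_self i)

theorem rootForm_mul_rootForm_sub_two (i j : B) :
    M.rootForm i (Finsupp.single j 1) * M.rootForm j (Finsupp.single i 1) - 2 =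
      2 * Real.cos (2 * (Real.pi / M i j)) := by
  rw [rootForm_single, rootForm_single, M.symmetric j i, Real.cos_two_mul]
  ring

theorem sin_two_mul_pi_div_ne_zero {m : ℕ} (hm : 3 ≤ m) :
    Real.sin (2 * (Real.pi / m)) ≠ 0 := by
  have h3 : (3 : ℝ) ≤ m := by exact_mod_cast hm
  have : 2 * (Real.pi / m) < Real.pi := by
    rw [← mul_div_assoc, div_lt_iff₀ (by linarith)]
    nlinarith [Real.pi_pos]
  exact (Real.sin_pos_of_pos_of_lt_pi (by positivity) this).ne'

open Polynomial.Chebyshev in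
theorem isLiftable_rootReflection : M.IsLiftable M.rootReflection := by
  intro i j
  by_cases hij : i = j
  · subst hij
    ext1 z
    simp [rootReflection, Module.involutive_reflection _ z]
  have h1 := M.off_diagonal i j hij
  ext1 z
  rw [rootReflection, rootReflection, Module.reflection_mul_reflection_pow_apply _ _ _ _
    (2 * Real.cos (2 * (Real.pi / M i j))) (M.rootForm_mul_rootForm_sub_two i j).symm]
  have hsin := S_two_mul_real_cos (2 * (Real.pi / M i j))
  rw [M.rootForm_single i j, M.rootForm_single j i, M.symmetric j i]
  generalize M i j = m at *
  obtain rfl | rfl | hm : m = 0 ∨ m = 2 ∨ 3 ≤ m := by omega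
  · simp
  · have hcos : Real.cos (2 * (Real.pi / (2 : ℕ))) = -1 := by
      rw [← Real.cos_pi]
      congr 1
      push_cast
      ring
    rw [hcos]
    simp
    module
  have hm0 : (m : ℝ) ≠ 0 := by positivity
  have hs := sin_two_mul_pi_div_ne_zero hm
  obtain ⟨p, rfl⟩ | ⟨p, rfl⟩ := m.even_or_odd
  · have hS : (S ℝ (p - 1)).eval (2 * Real.cos (2 * (Real.pi / (p + p : ℕ)))) = 0 := by
      refine (mul_eq_zero.1 ((hsin _).trans ?_)).resolve_right hs
      rw [← Real.sin_pi]
      congr 1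
      have : (p : ℝ) ≠ 0 := by rintro h; simp [h] at hm0
      push_cast
      field_simp
      ring
    rw [show (((p + p : ℕ) : ℤ) - 2) / 2 = p - 1 by omega,
      show (((p + p : ℕ) : ℤ) - 1) / 2 = p - 1 by omega, hS]
    simp
  · have hS : (S ℝ p).eval (2 * Real.cos (2 * (Real.pi / (2 * p + 1 : ℕ)))) +
        (S ℝ (p - 1)).eval (2 * Real.cos (2 * (Real.pi / (2 * p + 1 : ℕ)))) = 0 := by
      refine (mul_eq_zero.1 (Eq.trans ?_ (add_neg_cancel
        (Real.sin (((p : ℤ) + 1) * (2 * (Real.pi / (2 * p + 1 : ℕ)))))))).resolve_right hs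
      rw [add_mul, hsin, hsin, ← Real.sin_two_pi_sub]
      congr 2
      push_cast at hm0 ⊢
      field_simp
      ring
    rw [show (((2 * p + 1 : ℕ) : ℤ) - 2) / 2 = p - 1 by omega,
      show (((2 * p + 1 : ℕ) : ℤ) - 1) / 2 = p by omega,
      show (((2 * p + 1 : ℕ) : ℤ) - 3) / 2 = p - 1 by omega,
      show ((2 * p + 1 : ℕ) : ℤ) / 2 = p by omega, hS]
    simp

open Polynomial.Chebyshev in
theorem rootReflection_mul_pow_ne_one {i j : B} (hij : i ≠ j) {k : ℕ} (hk : 0 < k)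
    (hkM : M i j = 0 ∨ k < M i j) : (M.rootReflection i * M.rootReflection j) ^ k ≠ 1 := by
  intro h
  have hx := congrArg (fun e ↦ e (Finsupp.single i (1 : ℝ))) h
  simp only [rootReflection] at hx
  rw [Module.reflection_mul_reflection_pow_apply_self _ _ _
    (2 * Real.cos (2 * (Real.pi / M i j))) (M.rootForm_mul_rootForm_sub_two i j).symm] at hx
  have hi := DFunLike.congr_fun hx i
  have hj := DFunLike.congr_fun hx j
  simp only [M.rootForm_single j i, M.symmetric j i, Finsupp.add_apply, Finsupp.smul_apply,
    Finsupp.single_eq_same, Finsupp.single_eq_of_ne hij, Finsupp.single_eq_of_ne hij.symm,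
    smul_eq_mul, mul_zero, mul_one, add_zero, zero_add, LinearEquiv.coe_one, id_eq,
    mul_eq_zero] at hi hj
  have h1 := M.off_diagonal i j hij
  have hsin := S_two_mul_real_cos (2 * (Real.pi / M i j))
  generalize M i j = m at *
  obtain rfl | rfl | hm : m = 0 ∨ m = 2 ∨ 3 ≤ m := by omega
  · simp [S_eval_two] at hj
    omega
  · obtain rfl : k = 1 := by omega
    norm_num [mul_div_cancel₀] at hi
  have hs := sin_two_mul_pi_div_ne_zero hm
  have hcos : Real.cos (Real.pi / m) ≠ 0 := by
    rw [Real.sin_two_mul] at hs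
    exact right_ne_zero_of_mul hs
  have hS := hj.resolve_right (by simpa using hcos)
  have hsk := hsin (k - 1)
  have hsk' := hsin k
  rw [hS, add_zero] at hi
  rw [hS, zero_mul, Int.cast_sub, Int.cast_one, sub_add_cancel, Int.cast_natCast] at hsk
  rw [hi, one_mul, Int.cast_natCast, add_one_mul, Real.sin_add, ← hsk, zero_mul, zero_add] at hsk'
  have hcosk : Real.cos (k * (2 * (Real.pi / m))) = 1 := mul_right_cancel₀ hs (by linarith)
  have hkm : (k : ℝ) < m := by exact_mod_cast hkM.resolve_left (by omega)
  have hm0 : (0 : ℝ) < m := by positivity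
  have hlt : k * (2 * (Real.pi / m)) < 2 * Real.pi := by
    rw [show k * (2 * (Real.pi / m)) = 2 * Real.pi * k / m by ring, div_lt_iff₀ hm0]
    nlinarith [Real.pi_pos]
  have hpos : 0 < k * (2 * (Real.pi / m)) := by positivity
  exact hpos.ne' ((Real.cos_eq_one_iff_of_lt_of_lt (by linarith [Real.pi_pos]) hlt).1 hcosk)

end CoxeterMatrix

namespace CoxeterSystem

/-- The word of length `k` that alternates between `i` and `j`, starting with `i`. -/
def alternatingWordFrom {B : Type*} (i j : B) : ℕ → List B
  | 0 => []
  | k + 1 => i :: alternatingWordFrom j i k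

@[simp]
theorem length_alternatingWordFrom {B : Type*} (i j : B) (k : ℕ) :
    (alternatingWordFrom i j k).length = k := by
  induction k generalizing i j with
  | zero => rfl
  | succ k ih => simp [alternatingWordFrom, ih]

theorem alternatingWord_eq_alternatingWordFrom {B : Type*} (i j : B) (k : ℕ) :
    alternatingWord i j k =
      if Even k then alternatingWordFrom i j k else alternatingWordFrom j i k := by
  induction k with
  | zero => simp [alternatingWord, alternatingWordFrom]
  | succ k ih =>
    rw [alternatingWord_succ', ih]
    by_cases hk : Even k <;> simp [hk, Nat.even_add_one, alternatingWordFrom]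

theorem prod_map_alternatingWordFrom_two_mul {B G : Type*} [Monoid G] (f : B → G) (i j : B)
    (m : ℕ) : ((alternatingWordFrom i j (2 * m)).map f).prod = (f i * f j) ^ m := by
  induction m with
  | zero => simp [alternatingWordFrom]
  | succ m ih => simp [Nat.mul_succ, alternatingWordFrom, ih, pow_succ', mul_assoc]

theorem reverse_alternatingWordFrom_two_mul {B : Type*} (i j : B) (m : ℕ) :
    (alternatingWordFrom i j (2 * m)).reverse = alternatingWordFrom j i (2 * m) := by
  have concat_two (i j : B) (m : ℕ) :
      alternatingWordFrom i j (2 * m) ++ [i, j] = alternatingWordFrom i j (2 * (m + 1)) := by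
    induction m with
    | zero => rfl
    | succ m ih => rw [Nat.mul_succ]; simp only [alternatingWordFrom, List.cons_append, ih]; rfl
  induction m with
  | zero => rfl
  | succ m ih =>
    rw [← concat_two j i, ← ih, Nat.mul_succ]
    simp [alternatingWordFrom]

variable {B W : Type*} [Group W] {M : CoxeterMatrix B} (cs : CoxeterSystem M W)

theorem leftInvSeq_alternatingWordFrom (i j : B) (k : ℕ) :
    cs.leftInvSeq (alternatingWordFrom i j k) =
      (List.range k).map fun l ↦ (cs.simple i * cs.simple j) ^ l * cs.simple i := by
  induction k generalizing i j with
  | zero => rfl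
  | succ k ih =>
    have key (l : ℕ) : cs.simple i * (cs.simple j * cs.simple i) ^ l =
        (cs.simple i * cs.simple j) ^ l * cs.simple i :=
      ((SemiconjBy.pow_right (by simp [SemiconjBy, mul_assoc]) l : SemiconjBy (cs.simple i)
        ((cs.simple j * cs.simple i) ^ l) ((cs.simple i * cs.simple j) ^ l))).eq
    simp only [alternatingWordFrom, leftInvSeq, ih, List.range_succ_eq_map, List.map_cons,
      List.map_map, pow_zero, one_mul]
    congr 1
    refine List.map_congr_left fun l _ ↦ ?_
    simp only [Function.comp_apply, MulAut.conj_apply, inv_simple, ← mul_assoc, key]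
    simp [pow_succ, mul_assoc]

open scoped Classical in
theorem even_count_leftInvSeq_alternatingWordFrom (i j : B) (t : W) :
    Even ((cs.leftInvSeq (alternatingWordFrom i j (2 * M i j))).count t) := by
  rw [leftInvSeq_alternatingWordFrom, two_mul, List.range_add, List.map_append, List.map_map,
    List.count_append]
  simp [Function.comp_def, pow_add]

open scoped Classical in
/-- The self-map `(t, ε) ↦ (sᵢ t sᵢ, ε + [t = sᵢ])` of `W × ZMod 2`. -/
noncomputable def signedConj (i : B) : Function.End (W × ZMod 2) :=
  fun p ↦ (cs.simple i * p.1 * cs.simple i, p.2 + if p.1 = cs.simple i then 1 else 0)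

open scoped Classical in
theorem prod_map_signedConj_apply (ω : List B) (p : W × ZMod 2) :
    (ω.map cs.signedConj).prod p =
      (cs.wordProd ω * p.1 * (cs.wordProd ω)⁻¹, p.2 + ((cs.rightInvSeq ω).count p.1 : ℕ)) := by
  induction ω with
  | nil => simp [Function.End.one_def]
  | cons i ω ih =>
    rw [List.map_cons, List.prod_cons]
    change cs.signedConj i ((ω.map cs.signedConj).prod p) = _
    rw [ih]
    have : cs.wordProd ω * p.1 * (cs.wordProd ω)⁻¹ = cs.simple i ↔
        (cs.wordProd ω)⁻¹ * cs.simple i * cs.wordProd ω = p.1 := by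
      constructor <;> intro h <;> simp [← h, mul_assoc]
    rw [mul_assoc, mul_assoc] at this
    simp only [signedConj, wordProd_cons, rightInvSeq, List.count_cons, beq_iff_eq,
      mul_inv_rev, inv_simple, mul_assoc, add_assoc, Nat.cast_add, Nat.cast_ite, Nat.cast_one,
      Nat.cast_zero, this]

theorem isLiftable_signedConj : M.IsLiftable cs.signedConj := by
  classical
  intro i j
  rw [← prod_map_alternatingWordFrom_two_mul]
  funext p
  have hprod : cs.wordProd (alternatingWordFrom i j (2 * M i j)) = 1 := by
    rw [wordProd, prod_map_alternatingWordFrom_two_mul, simple_mul_simple_pow]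
  have heven : Even ((cs.rightInvSeq (alternatingWordFrom i j (2 * M i j))).count p.1) := by
    rw [← reverse_alternatingWordFrom_two_mul, rightInvSeq_reverse, List.count_reverse,
      M.symmetric i j]
    exact cs.even_count_leftInvSeq_alternatingWordFrom j i p.1
  rw [prod_map_signedConj_apply, hprod, (ZMod.natCast_eq_zero_iff_even).2 heven]
  simp [Function.End.one_def]

open scoped Classical in
theorem natCast_count_rightInvSeq_eq {ω ω' : List B} (h : cs.wordProd ω = cs.wordProd ω') (t : W) :
    ((cs.rightInvSeq ω).count t : ZMod 2) = (cs.rightInvSeq ω').count t := by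
  have key (ω : List B) : cs.lift ⟨_, cs.isLiftable_signedConj⟩ (cs.wordProd ω) (t, 0) =
      (cs.wordProd ω * t * (cs.wordProd ω)⁻¹, ((cs.rightInvSeq ω).count t : ZMod 2)) := by
    rw [wordProd, map_list_prod, List.map_map, ← wordProd]
    have : (cs.lift ⟨_, cs.isLiftable_signedConj⟩ : W → Function.End (W × ZMod 2)) ∘ cs.simple =
        cs.signedConj := funext fun i ↦ cs.lift_apply_simple _ i
    rw [this, prod_map_signedConj_apply, zero_add]
  have hω := key ω
  rw [h, key ω'] at hω
  exact (congrArg Prod.snd hω).symm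

/-- The exchange property. -/
theorem simple_mem_leftInvSeq {ω : List B} {i : B} (h : cs.IsLeftDescent (cs.wordProd ω) i) :
    cs.simple i ∈ cs.leftInvSeq ω := by
  classical
  obtain ⟨ω', hω', hprod⟩ := cs.exists_isReduced (cs.simple i * cs.wordProd ω)
  have hcons : cs.wordProd (i :: ω') = cs.wordProd ω := by simp [wordProd_cons, ← hprod]
  have hred : cs.IsReduced (i :: ω') := by
    rw [IsReduced, hcons, ← cs.isLeftDescent_iff.1 h, hprod, hω'.eq, List.length_cons]
  have hcount : (cs.leftInvSeq (i :: ω')).count (cs.simple i) = 1 :=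
    List.count_eq_one_of_mem hred.nodup_leftInvSeq (by simp [leftInvSeq])
  have hrev := cs.natCast_count_rightInvSeq_eq (ω := ω.reverse) (ω' := (i :: ω').reverse)
    (by simp only [wordProd_reverse, hcons]) (cs.simple i)
  rw [rightInvSeq_reverse, rightInvSeq_reverse, List.count_reverse, List.count_reverse, hcount]
    at hrev
  refine List.count_pos_iff.1 (Nat.pos_of_ne_zero fun h0 ↦ ?_)
  simp [h0] at hrev


theorem simple_mul_simple_pow_ne_one {i j : B} (hij : i ≠ j) {k : ℕ} (hk : 0 < k)
    (hkM : M i j = 0 ∨ k < M i j) : (cs.simple i * cs.simple j) ^ k ≠ 1 := by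
  intro h
  apply M.rootReflection_mul_pow_ne_one hij hk hkM
  simpa using congrArg (cs.lift ⟨_, M.isLiftable_rootReflection⟩) h

theorem exists_isReduced_alternatingWordFrom_append {w : W} {i j : B} (hij : i ≠ j)
    (hi : cs.IsLeftDescent w i) (hj : cs.IsLeftDescent w j) (k : ℕ)
    (hk : M i j = 0 ∨ k ≤ M i j) :
    ∃ r, cs.IsReduced (alternatingWordFrom i j k ++ r) ∧
      cs.wordProd (alternatingWordFrom i j k ++ r) = w := by
  induction k generalizing i j with
  | zero =>
    obtain ⟨r, hr, rfl⟩ := cs.exists_isReduced w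
    exact ⟨r, hr, rfl⟩
  | succ k ih =>
    rw [M.symmetric i j] at hk
    obtain ⟨r, hr, rfl⟩ := ih hij.symm hj hi (by omega)
    obtain ⟨n, hn, hni⟩ := List.mem_iff_getElem.1 (cs.simple_mem_leftInvSeq hi)
    have hn' : n < k + r.length := by simpa using hn
    have herase := cs.getD_leftInvSeq_mul_wordProd (alternatingWordFrom j i k ++ r) n
    rw [List.getD_eq_getElem _ _ hn, hni] at herase
    obtain hnk | hnk := lt_or_ge n k
    · have htake := cs.leftInvSeq_take (alternatingWordFrom j i k ++ r) k
      rw [List.take_left' (length_alternatingWordFrom j i k), leftInvSeq_alternatingWordFrom]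
        at htake
      have hget := congrArg (fun l ↦ l[n]?) htake
      simp only [List.getElem?_take, if_pos hnk, List.getElem?_eq_getElem hn, hni,
        List.getElem?_map, List.getElem?_range hnk, Option.map_some, Option.some.injEq] at hget
      refine absurd ?_ (cs.simple_mul_simple_pow_ne_one hij.symm n.succ_pos (by omega))
      rw [Nat.succ_eq_add_one, pow_succ, ← mul_assoc, hget, simple_mul_simple_self]
    · rw [List.eraseIdx_append_of_length_le (by simpa using hnk), length_alternatingWordFrom]
        at herase
      have hprod : cs.wordProd (alternatingWordFrom i j (k + 1) ++ r.eraseIdx (n - k)) =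
          cs.wordProd (alternatingWordFrom j i k ++ r) := by
        rw [alternatingWordFrom, List.cons_append, wordProd_cons, ← herase,
          simple_mul_simple_cancel_left]
      refine ⟨_, ?_, hprod⟩
      have hlen := List.length_eraseIdx_add_one (l := r) (i := n - k) (by omega)
      rw [IsReduced, hprod, hr.eq]
      simp only [List.length_append, length_alternatingWordFrom]
      omega

theorem exists_isReduced_braidWord_append {w : W} {i j : B} (hij : i ≠ j)
    (hi : cs.IsLeftDescent w i) (hj : cs.IsLeftDescent w j) :
    2 ≤ M i j ∧ ∃ r, cs.IsReduced (alternatingWordFrom i j (M i j) ++ r) ∧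
      cs.wordProd (alternatingWordFrom i j (M i j) ++ r) = w := by
  refine ⟨?_, cs.exists_isReduced_alternatingWordFrom_append hij hi hj _ (.inr le_rfl)⟩
  by_contra! hlt
  have := M.off_diagonal i j hij
  obtain ⟨r, hr, hprod⟩ := cs.exists_isReduced_alternatingWordFrom_append hij hi hj
    (cs.length w + 1) (.inl (by omega))
  have hlen := hr.eq
  rw [hprod, List.length_append, length_alternatingWordFrom] at hlen
  omega

theorem wordProd_alternatingWordFrom_eq (i j : B) :
    cs.wordProd (alternatingWordFrom i j (M i j)) =
      cs.wordProd (alternatingWordFrom j i (M i j)) := by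
  have := cs.wordProd_braidWord_eq i j
  simp only [braidWord, M.symmetric j i, alternatingWord_eq_alternatingWordFrom] at this
  split_ifs at this
  exacts [this, this.symm]

end CoxeterSystem

theorem BraidMoveRel.cons {B : Type*} {M : CoxeterMatrix B} {ω ω' : List B} (i : B)
    (h : BraidMoveRel M ω ω') : BraidMoveRel M (i :: ω) (i :: ω') := by
  obtain ⟨a, b, l₁, l₂, hM, rfl, rfl⟩ := h
  exact ⟨a, b, i :: l₁, l₂, hM, rfl, rfl⟩

open CoxeterSystem in
theorem BraidMoveRel.alternatingWordFrom_append {B : Type*} {M : CoxeterMatrix B} {i j : B}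
    (hM : 2 ≤ M i j) (r : List B) :
    BraidMoveRel M (alternatingWordFrom i j (M i j) ++ r)
      (alternatingWordFrom j i (M i j) ++ r) := by
  by_cases hm : Even (M i j)
  · exact ⟨i, j, [], r, hM, by simp [alternatingWord_eq_alternatingWordFrom, hm]⟩
  · refine ⟨j, i, [], r, M.symmetric i j ▸ hM, ?_⟩
    simp [alternatingWord_eq_alternatingWordFrom, M.symmetric j i, hm]

namespace CoxeterSystem

variable {B W : Type*} [Group W] {M : CoxeterMatrix B} {cs : CoxeterSystem M W}

theorem IsReduced.isLeftDescent {i : B} {ω : List B} (h : cs.IsReduced (i :: ω)) :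
    cs.IsLeftDescent (cs.wordProd (i :: ω)) i := by
  rw [← isLeftInversion_simple_iff_isLeftDescent]
  exact cs.isLeftInversion_of_mem_leftInvSeq h (by simp [leftInvSeq])

end CoxeterSystem

/-- **Matsumoto's theorem.** If `ω` and `ω'` are reduced words with the same product in `W`,
then `ω'` can be obtained from `ω` by a finite sequence of braid moves. -/
theorem matsumoto {B : Type*} {W : Type*} [Group W] {M : CoxeterMatrix B}
    (cs : CoxeterSystem M W) (ω ω' : List B)
    (hω : cs.IsReduced ω) (hω' : cs.IsReduced ω')
    (h : cs.wordProd ω = cs.wordProd ω') :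
    Relation.ReflTransGen (BraidMoveRel M) ω ω' := by
  induction hn : ω.length generalizing ω ω' with
  | zero =>
    have hlen : ω.length = ω'.length := by rw [← hω.eq, ← hω'.eq, h]
    rw [List.length_eq_zero_iff.1 hn, List.length_eq_zero_iff.1 (hlen.symm.trans hn)]
  | succ n ih =>
    have same_head (i : B) (u v : List B) (hu : cs.IsReduced (i :: u))
        (hv : cs.IsReduced (i :: v)) (huv : cs.wordProd (i :: u) = cs.wordProd (i :: v))
        (hun : (i :: u).length = n + 1) :
        Relation.ReflTransGen (BraidMoveRel M) (i :: u) (i :: v) := by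
      rw [cs.wordProd_cons, cs.wordProd_cons, mul_right_inj] at huv
      exact (ih u v (hu.drop 1) (hv.drop 1) huv (by simpa using hun)).lift
        (List.cons i) fun _ _ ↦ BraidMoveRel.cons i
    have hlen : ω.length = ω'.length := by rw [← hω.eq, ← hω'.eq, h]
    obtain ⟨i, u, rfl⟩ := List.exists_cons_of_length_eq_add_one hn
    obtain ⟨j, v, rfl⟩ := List.exists_cons_of_length_eq_add_one (hlen.symm.trans hn)
    obtain rfl | hij := eq_or_ne i j
    · exact same_head i u v hω hω' h hn
    obtain ⟨hM, r, hr, hrprod⟩ := cs.exists_isReduced_braidWord_append hij hω.isLeftDescent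
      (h ▸ hω'.isLeftDescent)
    have hprod : cs.wordProd (CoxeterSystem.alternatingWordFrom j i (M i j) ++ r) =
        cs.wordProd (j :: v) := by
      rw [← h, ← hrprod, cs.wordProd_append, cs.wordProd_append,
        cs.wordProd_alternatingWordFrom_eq]
    have hr' : cs.IsReduced (CoxeterSystem.alternatingWordFrom j i (M i j) ++ r) := by
      rw [CoxeterSystem.IsReduced, hprod, ← h, ← hrprod, hr.eq]
      simp
    have hrlen : (CoxeterSystem.alternatingWordFrom j i (M i j) ++ r).length = n + 1 := by
      rw [← hr'.eq, hprod, hω'.eq, ← hlen, hn]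
    have hbraid := BraidMoveRel.alternatingWordFrom_append hM r
    obtain ⟨m, hm⟩ := Nat.exists_eq_add_of_le' (Nat.one_le_of_lt hM)
    rw [hm] at hr hr' hrprod hprod hrlen hbraid
    exact ((same_head i _ _ hω hr hrprod.symm hn).tail hbraid).trans
      (same_head j _ _ hr' hω' hprod hrlen)
end

section
/- For n ≥ 1, the Coxeter group of the Coxeter matrix of type Aₙ (Mathlib's CoxeterMatrix.Aₙ n, indexed by Fin n) is isomorphic, as a group, to the symmetric group on n+1 letters, via an isomorphism sending the i-th simple generator to the transposition swapping i and i+1 (Equiv.swap i.castSucc i.succ in Equiv.Perm (Fin (n+1))). -/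
/-- A sequence in a group whose first `N` terms satisfy the defining relations of the Coxeter
group of type `A_N`. -/
structure IsTypeASequence {G : Type*} [Group G] (f : ℕ → G) (N : ℕ) : Prop where
  mul_self : ∀ i < N, f i * f i = 1
  commute : ∀ i j, i + 1 < j → j < N → Commute (f i) (f j)
  braid : ∀ i, i + 1 < N → f i * f (i + 1) * f i = f (i + 1) * f i * f (i + 1)

namespace IsTypeASequence

variable {G : Type*} [Group G] {f : ℕ → G} {N : ℕ}

/-- The product `f k * f (k + 1) * ⋯ * f (k + d - 1)`. -/
def intervalProd (f : ℕ → G) (k d : ℕ) : G := ((List.range' k d).map f).prod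

@[simp]
theorem intervalProd_zero (f : ℕ → G) (k : ℕ) : intervalProd f k 0 = 1 := by
  simp [intervalProd]

theorem intervalProd_succ (f : ℕ → G) (k d : ℕ) :
    intervalProd f k (d + 1) = f k * intervalProd f (k + 1) d := by
  simp [intervalProd, List.range'_succ]

theorem intervalProd_succ_right (f : ℕ → G) (k d : ℕ) :
    intervalProd f k (d + 1) = intervalProd f k d * f (k + d) := by
  simp [intervalProd, List.range'_1_concat]

theorem commute_intervalProd (hf : IsTypeASequence f N) {i k d : ℕ} (hik : i + 1 < k)
    (hkd : k + d ≤ N) : Commute (f i) (intervalProd f k d) := by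
  induction d with
  | zero => simp
  | succ d ih =>
    rw [intervalProd_succ_right]
    exact (ih (by omega)).mul_right (hf.commute i (k + d) (by omega) (by omega))

theorem mul_intervalProd_eq_intervalProd_mul (hf : IsTypeASequence f N) {j k d : ℕ} (hkj : k ≤ j)
    (hjd : j + 1 < k + d) (hkd : k + d ≤ N) :
    f (j + 1) * intervalProd f k d = intervalProd f k d * f j := by
  induction d generalizing k with
  | zero => omega
  | succ d ih =>
    rcases hkj.eq_or_lt with rfl | hlt
    · obtain ⟨d, rfl⟩ : ∃ e, d = e + 1 := ⟨d - 1, by omega⟩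
      rw [intervalProd_succ, intervalProd_succ]
      have hc := hf.commute_intervalProd (i := k) (k := k + 1 + 1) (d := d) (by omega) (by omega)
      calc f (k + 1) * (f k * (f (k + 1) * intervalProd f (k + 1 + 1) d))
          = f k * f (k + 1) * f k * intervalProd f (k + 1 + 1) d := by
            rw [hf.braid k (by omega)]; simp only [mul_assoc]
        _ = f k * (f (k + 1) * intervalProd f (k + 1 + 1) d) * f k := by
            simp only [mul_assoc, hc.eq]
    · have hc := hf.commute k (j + 1) (by omega) (by omega)
      rw [intervalProd_succ, ← mul_assoc, ← hc.eq, mul_assoc,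
        ih (by omega) (by omega) (by omega), mul_assoc]

theorem exists_eq_intervalProd_mul (hf : IsTypeASequence f N) {m : ℕ} (hm : m < N) {w : G}
    (hw : w ∈ Subgroup.closure (f '' Set.Iio (m + 1))) :
    ∃ k d : ℕ, k + d = m + 1 ∧
      ∃ h ∈ Subgroup.closure (f '' Set.Iio m), w = intervalProd f k d * h := by
  have step : ∀ i < m + 1, ∀ w : G,
      (∃ k d : ℕ, k + d = m + 1 ∧
        ∃ h ∈ Subgroup.closure (f '' Set.Iio m), w = intervalProd f k d * h) →
      ∃ k d : ℕ, k + d = m + 1 ∧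
        ∃ h ∈ Subgroup.closure (f '' Set.Iio m), f i * w = intervalProd f k d * h := by
    rintro i hi _ ⟨k, d, hkd, h, hh, rfl⟩
    have mem : ∀ j < m, f j * h ∈ Subgroup.closure (f '' Set.Iio m) := fun j hj =>
      mul_mem (Subgroup.subset_closure ⟨j, hj, rfl⟩) hh
    rcases lt_trichotomy i k with hik | rfl | hki
    · by_cases hik' : i + 1 = k
      · subst hik'
        exact ⟨i, d + 1, by omega, h, hh, by rw [intervalProd_succ, mul_assoc]⟩
      · refine ⟨k, d, hkd, f i * h, mem i (by omega), ?_⟩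
        rw [← mul_assoc, (hf.commute_intervalProd (by omega) (by omega)).eq, mul_assoc]
    · obtain ⟨d, rfl⟩ : ∃ e, d = e + 1 := ⟨d - 1, by omega⟩
      refine ⟨i + 1, d, by omega, h, hh, ?_⟩
      rw [intervalProd_succ, ← mul_assoc, ← mul_assoc, hf.mul_self i (by omega), one_mul]
    · obtain ⟨j, rfl⟩ : ∃ j, i = j + 1 := ⟨i - 1, by omega⟩
      refine ⟨k, d, hkd, f j * h, mem j (by omega), ?_⟩
      rw [← mul_assoc, hf.mul_intervalProd_eq_intervalProd_mul (by omega) (by omega) (by omega),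
        mul_assoc]
  induction hw using Subgroup.closure_induction_left with
  | one => exact ⟨m + 1, 0, rfl, 1, one_mem _, by simp⟩
  | mul_left x hx y _ ih =>
    obtain ⟨i, hi, rfl⟩ := hx
    exact step i hi y ih
  | inv_mul_cancel x hx y _ ih =>
    obtain ⟨i, hi, rfl⟩ := hx
    rw [inv_eq_of_mul_eq_one_left (hf.mul_self i (lt_of_lt_of_le hi hm))]
    exact step i hi y ih

theorem map_intervalProd_apply {φ : G →* Equiv.Perm ℕ}
    (hφ : ∀ i < N, φ (f i) = Equiv.swap i (i + 1)) {k d : ℕ} (hkd : k + d ≤ N) :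
    φ (intervalProd f k d) (k + d) = k := by
  induction d with
  | zero => simp
  | succ d ih =>
    rw [intervalProd_succ_right, map_mul, Equiv.Perm.mul_apply, hφ _ (by omega), ← add_assoc,
      Equiv.swap_apply_right, ih (by omega)]

theorem map_apply_of_mem_closure {φ : G →* Equiv.Perm ℕ}
    (hφ : ∀ i < N, φ (f i) = Equiv.swap i (i + 1)) {m x : ℕ} (hm : m ≤ N) (hx : m < x) {w : G}
    (hw : w ∈ Subgroup.closure (f '' Set.Iio m)) : φ w x = x := by
  suffices Subgroup.closure (f '' Set.Iio m) ≤
      (MulAction.stabilizer (Equiv.Perm ℕ) x).comap φ from this hw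
  rw [Subgroup.closure_le]
  rintro _ ⟨i, hi, rfl⟩
  have hi' : i < m := hi
  change φ (f i) x = x
  rw [hφ i (by omega), Equiv.swap_apply_of_ne_of_ne (by omega) (by omega)]

theorem eq_one_of_map_eq_one (hf : IsTypeASequence f N) {φ : G →* Equiv.Perm ℕ}
    (hφ : ∀ i < N, φ (f i) = Equiv.swap i (i + 1)) {m : ℕ} (hm : m ≤ N) {w : G}
    (hw : w ∈ Subgroup.closure (f '' Set.Iio m)) (h1 : φ w = 1) : w = 1 := by
  induction m generalizing w with
  | zero => simpa using hw
  | succ m ih =>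
    obtain ⟨k, d, hkd, h, hh, rfl⟩ := hf.exists_eq_intervalProd_mul hm hw
    have hk : φ (intervalProd f k d * h) (m + 1) = k := by
      rw [map_mul, Equiv.Perm.mul_apply,
        map_apply_of_mem_closure hφ (by omega) (lt_add_one m) hh, ← hkd,
        map_intervalProd_apply hφ (by omega)]
    rw [h1, Equiv.Perm.one_apply] at hk
    obtain rfl : d = 0 := by omega
    rw [intervalProd_zero, one_mul] at h1 ⊢
    exact ih (by omega) hh h1

end IsTypeASequence

theorem isLiftable_swap_castSucc_succ (n : ℕ) :
    (CoxeterMatrix.A n).IsLiftable fun i : Fin n => Equiv.swap i.castSucc i.succ := by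
  intro i j
  by_cases hij : i = j
  · subst hij
    simp [CoxeterMatrix.A]
  have hij' : (i : ℕ) ≠ j := fun h => hij (Fin.ext h)
  by_cases h3 : (j : ℕ) + 1 = i ∨ (i : ℕ) + 1 = j
  · have hM : CoxeterMatrix.A n i j = 3 := by
      change (if i = j then 1 else _) = _
      rw [if_neg hij, if_pos h3]
    rw [hM]
    ext x
    simp only [pow_succ, pow_zero, one_mul, Equiv.Perm.mul_apply, Equiv.Perm.one_apply,
      Equiv.swap_apply_def, Fin.ext_iff, Fin.val_castSucc, Fin.val_succ]
    grind
  · have hM : CoxeterMatrix.A n i j = 2 := by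
      change (if i = j then 1 else _) = _
      rw [if_neg hij, if_neg h3]
    rw [hM]
    ext x
    simp only [pow_succ, pow_zero, one_mul, Equiv.Perm.mul_apply, Equiv.Perm.one_apply,
      Equiv.swap_apply_def, Fin.ext_iff, Fin.val_castSucc, Fin.val_succ]
    grind

/-- The simple generators of a Coxeter system of type `A`, extended by `1` to a sequence. -/
def CoxeterSystem.simpleSeq {n : ℕ} {W : Type*} [Group W]
    (cs : CoxeterSystem (CoxeterMatrix.A n) W) (i : ℕ) : W :=
  if h : i < n then cs.simple ⟨i, h⟩ else 1

theorem CoxeterSystem.isTypeASequence_simpleSeq {n : ℕ} {W : Type*} [Group W]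
    (cs : CoxeterSystem (CoxeterMatrix.A n) W) : IsTypeASequence cs.simpleSeq n where
  mul_self i hi := by simp [simpleSeq, hi]
  commute i j hij hj := by
    have hi : i < n := by omega
    have h := cs.simple_mul_simple_pow ⟨i, hi⟩ ⟨j, hj⟩
    have hM : CoxeterMatrix.A n ⟨i, hi⟩ ⟨j, hj⟩ = 2 := by
      change (if _ then 1 else if _ then 3 else 2) = _
      rw [if_neg (by simp; omega), if_neg (by simp; omega)]
    rw [hM, pow_two, mul_eq_one_iff_eq_inv, mul_inv_rev, cs.inv_simple, cs.inv_simple] at h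
    simpa [simpleSeq, hi, hj, commute_iff_eq] using h
  braid i hi := by
    have hi' : i < n := by omega
    have h := cs.simple_mul_simple_pow ⟨i, hi'⟩ ⟨i + 1, hi⟩
    have hM : CoxeterMatrix.A n ⟨i, hi'⟩ ⟨i + 1, hi⟩ = 3 := by
      change (if _ then 1 else if _ then 3 else 2) = _
      rw [if_neg (by simp), if_pos (by simp)]
    simp only [simpleSeq, hi, hi', dif_pos]
    rw [hM] at h
    generalize hs : cs.simple ⟨i, hi'⟩ = s at h ⊢
    generalize ht : cs.simple ⟨i + 1, hi⟩ = t at h ⊢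
    have hst : s * t * s * (t * s * t) = 1 := by simpa only [pow_three, mul_assoc] using h
    have hinv : (t * s * t)⁻¹ = t * s * t := by
      simp only [mul_inv_rev, ← hs, ← ht, cs.inv_simple, mul_assoc]
    rw [mul_eq_one_iff_eq_inv.mp hst, hinv]

theorem injective_of_apply_simple_eq_swap {n : ℕ} {W : Type*} [Group W]
    (cs : CoxeterSystem (CoxeterMatrix.A n) W) (φ : W →* Equiv.Perm (Fin (n + 1)))
    (hφ : ∀ i : Fin n, φ (cs.simple i) = Equiv.swap i.castSucc i.succ) :
    Function.Injective φ := by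
  let ψ : W →* Equiv.Perm ℕ := (Equiv.Perm.viaEmbeddingHom Fin.valEmbedding).comp φ
  have hψ : ∀ i < n, ψ (cs.simpleSeq i) = Equiv.swap i (i + 1) := by
    intro i hi
    change (φ (cs.simpleSeq i)).viaEmbedding Fin.valEmbedding = _
    rw [CoxeterSystem.simpleSeq, dif_pos hi, hφ]
    ext x
    by_cases hx : x < n + 1
    · have := Equiv.Perm.viaEmbedding_apply
        (Equiv.swap (Fin.castSucc ⟨i, hi⟩) (Fin.succ ⟨i, hi⟩)) Fin.valEmbedding ⟨x, hx⟩
      simp only [Fin.valEmbedding_apply] at this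
      rw [this]
      simp only [Equiv.swap_apply_def, Fin.ext_iff]
      grind
    · rw [Equiv.Perm.viaEmbedding_apply_of_notMem _ _ _ (by simpa using hx),
        Equiv.swap_apply_of_ne_of_ne (by omega) (by omega)]
  rw [injective_iff_map_eq_one]
  intro w hw
  refine cs.isTypeASequence_simpleSeq.eq_one_of_map_eq_one hψ le_rfl ?_ (by simp [ψ, hw])
  have hle : Subgroup.closure (Set.range cs.simple) ≤
      Subgroup.closure (cs.simpleSeq '' Set.Iio n) := by
    refine Subgroup.closure_mono ?_
    rintro _ ⟨i, rfl⟩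
    exact ⟨i, i.2, by simp [CoxeterSystem.simpleSeq]⟩
  exact hle (cs.subgroup_closure_range_simple ▸ Subgroup.mem_top w)

theorem surjective_of_apply_simple_eq_swap {n : ℕ} {W : Type*} [Group W]
    (cs : CoxeterSystem (CoxeterMatrix.A n) W) (φ : W →* Equiv.Perm (Fin (n + 1)))
    (hφ : ∀ i : Fin n, φ (cs.simple i) = Equiv.swap i.castSucc i.succ) :
    Function.Surjective φ := by
  rw [← MonoidHom.mrange_eq_top, eq_top_iff, ← Equiv.Perm.mclosure_swap_castSucc_succ,
    Submonoid.closure_le]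
  rintro _ ⟨i, rfl⟩
  exact ⟨cs.simple i, hφ i⟩

/-- The Coxeter group of type `Aₙ` (`n ≥ 1`) is isomorphic to the symmetric group on `n + 1`
letters, via an isomorphism sending the `i`-th simple generator to the transposition
swapping `i` and `i + 1`. -/
theorem coxeterAn_mulEquiv_symmetricGroup (n : ℕ) (hn : 1 ≤ n) :
    ∃ e : (CoxeterMatrix.Aₙ n).Group ≃* Equiv.Perm (Fin (n + 1)),
      ∀ i : Fin n, e ((CoxeterMatrix.Aₙ n).simple i) = Equiv.swap i.castSucc i.succ := by
  let cs := (CoxeterMatrix.A n).toCoxeterSystem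
  let φ := cs.lift ⟨_, isLiftable_swap_castSucc_succ n⟩
  have hφ : ∀ i : Fin n, φ (cs.simple i) = Equiv.swap i.castSucc i.succ :=
    cs.lift_apply_simple (isLiftable_swap_castSucc_succ n)
  exact ⟨MulEquiv.ofBijective φ ⟨injective_of_apply_simple_eq_swap cs φ hφ,
    surjective_of_apply_simple_eq_swap cs φ hφ⟩, hφ⟩
end

section
/- (Fan) For n ≥ 4, the Temperley–Lieb algebra TL(Dₙ), defined by its presentation over ℤ[δ], is a free ℤ[δ]-module of rank ((n+3)·catalan n − 2)/2; i.e., Module.rank ℤ[δ] TL(Dₙ) = ((n+3)·C(n))/2 − 1 where C(n) is the n-th Catalan number. -/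
noncomputable section

/-- Adjacency in the Coxeter graph of type `Dₙ`: the index set is `Fin n`, where `0`
stands for the generator `s₁̄` and `k` stands for `sₖ` for `1 ≤ k ≤ n − 1`.  The vertex
`s₁̄` is joined to `s₂`, and the vertices `s₁, …, s_{n−1}` form a path. -/
def DnAdj (n : ℕ) (i j : Fin n) : Prop :=
  ((i : ℕ) = 0 ∧ (j : ℕ) = 2) ∨ ((j : ℕ) = 0 ∧ (i : ℕ) = 2) ∨
    (1 ≤ (i : ℕ) ∧ 1 ≤ (j : ℕ) ∧ ((i : ℕ) + 1 = (j : ℕ) ∨ (j : ℕ) + 1 = (i : ℕ)))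

/-- The defining relations of the Temperley–Lieb algebra associated to a graph with vertex
type `V` and adjacency relation `Adj`, over a commutative ring `R` with parameter `δ`:
`bᵢ² = δ·bᵢ`; `bᵢbⱼ = bⱼbᵢ` when `i, j` are not joined; `bᵢbⱼbᵢ = bᵢ` when `i, j` are joined. -/
inductive TLRel (R : Type*) [CommRing R] (δ : R) {V : Type*} (Adj : V → V → Prop) :
    FreeAlgebra R V → FreeAlgebra R V → Prop
  | idem (i : V) :
      TLRel R δ Adj (FreeAlgebra.ι R i * FreeAlgebra.ι R i) (δ • FreeAlgebra.ι R i)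
  | comm (i j : V) (hne : i ≠ j) (h : ¬ Adj i j) :
      TLRel R δ Adj (FreeAlgebra.ι R i * FreeAlgebra.ι R j)
        (FreeAlgebra.ι R j * FreeAlgebra.ι R i)
  | braid (i j : V) (h : Adj i j) :
      TLRel R δ Adj (FreeAlgebra.ι R i * FreeAlgebra.ι R j * FreeAlgebra.ι R i)
        (FreeAlgebra.ι R i)

/-- The Temperley–Lieb algebra of a graph `(V, Adj)` over `R` with parameter `δ`, presented
by generators `bᵢ` (`i : V`) and the Temperley–Lieb relations. -/
def TLAlg (R : Type*) [CommRing R] (δ : R) {V : Type*} (Adj : V → V → Prop) : Type _ :=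
  RingQuot (TLRel R δ Adj)

instance (R : Type*) [CommRing R] (δ : R) {V : Type*} (Adj : V → V → Prop) :
    Ring (TLAlg R δ Adj) := by unfold TLAlg; infer_instance

instance (R : Type*) [CommRing R] (δ : R) {V : Type*} (Adj : V → V → Prop) :
    Algebra R (TLAlg R δ Adj) := by unfold TLAlg; infer_instance

/-- The Temperley–Lieb algebra `TL(Dₙ)` over `ℤ[δ] = Polynomial ℤ`, with `δ = X`. -/
def TLD (n : ℕ) : Type _ := TLAlg (Polynomial ℤ) Polynomial.X (DnAdj n)

instance (n : ℕ) : Ring (TLD n) := by unfold TLD; infer_instance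

instance (n : ℕ) : Algebra (Polynomial ℤ) (TLD n) := by unfold TLD; infer_instance

/-- A perfect matching of the integers whose arcs are labelled by `ZMod 2`. -/
@[ext] structure LabelledMatching where
  partner : ℤ → ℤ
  label : ℤ → ZMod 2
  partner_partner : ∀ x, partner (partner x) = x
  partner_ne : ∀ x, partner x ≠ x
  label_partner : ∀ x, label (partner x) = label x

namespace LabelledMatching

/-- Join `p` and `q` by an arc labelled `ε`, and join their former partners, adding up labels. -/
def join (p q : ℤ) (hpq : p ≠ q) (ε : ZMod 2) (s : LabelledMatching) : LabelledMatching where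
  partner x := if x = p then q else if x = q then p else if x = s.partner p then s.partner q
    else if x = s.partner q then s.partner p else s.partner x
  label x := if x = p ∨ x = q then ε else
    if x = s.partner p ∨ x = s.partner q then s.label p + s.label q + ε else s.label x
  partner_partner x := by
    have h1 := s.partner_partner
    have h2 := s.partner_ne
    grind
  partner_ne x := by
    have h1 := s.partner_partner
    have h2 := s.partner_ne
    grind
  label_partner x := by
    have h1 := s.partner_partner
    have h2 := s.partner_ne
    have h3 := s.label_partner
    grind

theorem join_partner_left (p q : ℤ) (hpq : p ≠ q) (ε : ZMod 2) (s : LabelledMatching) :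
    (s.join p q hpq ε).partner p = q := by simp [join]

theorem join_label_left (p q : ℤ) (hpq : p ≠ q) (ε : ZMod 2) (s : LabelledMatching) :
    (s.join p q hpq ε).label p = ε := by simp [join]

theorem join_join_of_partner {p q r : ℤ} (hpq : p ≠ q) (hqr : q ≠ r) (hpr : p ≠ r) (ε η : ZMod 2)
    (s : LabelledMatching) (hs : s.partner p = q) (hl : s.label p = ε) :
    (s.join q r hqr η).join p q hpq ε = s := by
  have h1 := s.partner_partner
  have h2 := s.partner_ne
  have h3 := s.label_partner
  ext x
  · simp only [join]
    grind
  · have := CharTwo.add_self_eq_zero ε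
    have := CharTwo.add_self_eq_zero η
    simp only [join]
    grind

theorem join_of_partner {p q : ℤ} (hpq : p ≠ q) (ε : ZMod 2)
    (s : LabelledMatching) (hs : s.partner p = q) (hl : s.label p = ε) :
    s.join p q hpq ε = s := by
  have h1 := s.partner_partner
  have h3 := s.label_partner
  ext x
  · simp only [join]
    grind
  · simp only [join]
    grind

/-- The coefficient produced by joining `p` and `q` with an arc labelled `ε`: a closed loop
contributes `δ` if it is unlabelled and `0` otherwise. -/
def weight (p q : ℤ) (ε : ZMod 2) (s : LabelledMatching) : Polynomial ℤ :=
  if s.partner p = q then if s.label p = ε then Polynomial.X else 0 else 1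

/-- The linear map joining `p` and `q` by an arc labelled `ε`, weighted by the loop created. -/
def joinHom (p q : ℤ) (hpq : p ≠ q) (ε : ZMod 2) :
    Module.End (Polynomial ℤ) (LabelledMatching →₀ Polynomial ℤ) :=
  Finsupp.lsum (Polynomial ℤ) fun s => s.weight p q ε • Finsupp.lsingle (s.join p q hpq ε)

theorem joinHom_single (p q : ℤ) (hpq : p ≠ q) (ε : ZMod 2) (s : LabelledMatching)
    (c : Polynomial ℤ) : joinHom p q hpq ε (Finsupp.single s c) =
      s.weight p q ε • Finsupp.single (s.join p q hpq ε) c := by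
  simp [joinHom]

theorem joinHom_mul_self (p q : ℤ) (hpq : p ≠ q) (ε : ZMod 2) :
    joinHom p q hpq ε * joinHom p q hpq ε = (Polynomial.X : Polynomial ℤ) • joinHom p q hpq ε := by
  refine Finsupp.lhom_ext fun s c => ?_
  have h : (s.join p q hpq ε).weight p q ε = Polynomial.X := by simp [weight, join]
  have h' : (s.join p q hpq ε).join p q hpq ε = s.join p q hpq ε :=
    join_of_partner _ _ _ (join_partner_left ..) (join_label_left ..)
  simp only [Module.End.mul_apply, LinearMap.smul_apply, joinHom_single, map_smul, h, h']
  rw [smul_comm]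

theorem joinHom_braid {p q r : ℤ} (hpq : p ≠ q) (hqr : q ≠ r) (hpr : p ≠ r) (ε η : ZMod 2) :
    joinHom p q hpq ε * joinHom q r hqr η * joinHom p q hpq ε = joinHom p q hpq ε := by
  refine Finsupp.lhom_ext fun s c => ?_
  have h1 : (s.join p q hpq ε).weight q r η = 1 := by
    have h2 := s.partner_ne
    simp only [weight, join]
    grind
  have h2 : ((s.join p q hpq ε).join q r hqr η).weight p q ε = 1 := by
    have h2 := s.partner_ne
    have h3 := s.partner_partner
    simp only [weight, join]
    grind
  have h' : ((s.join p q hpq ε).join q r hqr η).join p q hpq ε = s.join p q hpq ε :=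
    join_join_of_partner _ _ hpr _ _ _ (join_partner_left ..) (join_label_left ..)
  simp only [Module.End.mul_apply, joinHom_single, map_smul, h', h1, h2, one_smul]

theorem join_swap (p q : ℤ) (hpq : p ≠ q) (ε : ZMod 2) (s : LabelledMatching) :
    s.join q p hpq.symm ε = s.join p q hpq ε := by
  ext x
  · simp only [join]
    grind
  · simp only [join]
    grind

theorem weight_swap (p q : ℤ) (ε : ZMod 2) (s : LabelledMatching) :
    s.weight q p ε = s.weight p q ε := by
  have h1 := s.label_partner
  have h3 := s.partner_partner
  simp only [weight]
  grind

theorem joinHom_swap (p q : ℤ) (hpq : p ≠ q) (ε : ZMod 2) :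
    joinHom q p hpq.symm ε = joinHom p q hpq ε := by
  refine Finsupp.lhom_ext fun s c => ?_
  simp only [joinHom_single, join_swap p q hpq, weight_swap]

theorem join_join_comm {p q p' q' : ℤ} (hpq : p ≠ q) (hpq' : p' ≠ q') (hpp : p ≠ p') (hpr : p ≠ q')
    (hqp : q ≠ p') (hqq : q ≠ q') (ε ε' : ZMod 2) (s : LabelledMatching)
    (h : s.partner p = p' → s.partner q = q' → s.label p + s.label q + ε = ε')
    (h' : s.partner p = q' → s.partner q = p' → s.label p + s.label q + ε = ε') :
    (s.join p q hpq ε).join p' q' hpq' ε' = (s.join p' q' hpq' ε').join p q hpq ε := by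
  have h1 := s.partner_partner
  have h2 := s.partner_ne
  have h3 := s.label_partner
  have := CharTwo.add_self_eq_zero ε
  have := CharTwo.add_self_eq_zero ε'
  ext x
  · simp only [join]
    grind (splits := 20)
  · simp only [join]
    grind (splits := 20)

theorem weight_mul_weight_comm {p q p' q' : ℤ} (hpq : p ≠ q) (hpq' : p' ≠ q') (hpp : p ≠ p')
    (hpr : p ≠ q') (hqp : q ≠ p') (hqq : q ≠ q') (ε ε' : ZMod 2) (s : LabelledMatching) :
    s.weight p q ε * (s.join p q hpq ε).weight p' q' ε' =
      s.weight p' q' ε' * (s.join p' q' hpq' ε').weight p q ε := by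
  have h1 := s.partner_partner
  have h2 := s.partner_ne
  have h3 := s.label_partner
  have := CharTwo.add_self_eq_zero ε
  have := CharTwo.add_self_eq_zero ε'
  have := CharTwo.add_self_eq_zero (s.label p)
  have := CharTwo.add_self_eq_zero (s.label q)
  simp only [weight, join]
  grind (splits := 30)

theorem weight_join_eq_zero {p q p' q' : ℤ} (hpq : p ≠ q) (hpq' : p' ≠ q') (hpp : p ≠ p')
    (hqp : q ≠ p') (ε ε' : ZMod 2) (s : LabelledMatching)
    (h : (s.partner p = p' ∧ s.partner q = q' ∨ s.partner p = q' ∧ s.partner q = p') ∧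
      s.label p + s.label q + ε ≠ ε') :
    (s.join p q hpq ε).weight p' q' ε' = 0 := by
  have h2 := s.partner_ne
  simp only [weight, join]
  grind

theorem joinHom_comm {p q p' q' : ℤ} (hpq : p ≠ q) (hpq' : p' ≠ q') (hpp : p ≠ p') (hpr : p ≠ q')
    (hqp : q ≠ p') (hqq : q ≠ q') (ε ε' : ZMod 2) :
    joinHom p q hpq ε * joinHom p' q' hpq' ε' = joinHom p' q' hpq' ε' * joinHom p q hpq ε := by
  refine Finsupp.lhom_ext fun s c => ?_
  have hw := weight_mul_weight_comm hpq hpq' hpp hpr hqp hqq ε ε' s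
  simp only [Module.End.mul_apply, joinHom_single, map_smul, smul_smul, ← hw]
  by_cases h : (s.partner p = p' ∧ s.partner q = q' ∨ s.partner p = q' ∧ s.partner q = p') ∧
      s.label p + s.label q + ε ≠ ε'
  · simp [weight_join_eq_zero hpq hpq' hpp hqp ε ε' s h]
  · rw [join_join_comm hpq hpq' hpp hpr hqp hqq ε ε' s (by grind) (by grind)]

theorem joinHom_mul_of_ne (p q : ℤ) (hpq : p ≠ q) {ε ε' : ZMod 2} (h : ε ≠ ε') :
    joinHom p q hpq ε * joinHom p q hpq ε' = 0 := by
  refine Finsupp.lhom_ext fun s c => ?_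
  have h' : (s.join p q hpq ε').weight p q ε = 0 := by simp [weight, join, h.symm]
  simp only [Module.End.mul_apply, joinHom_single, map_smul, h', zero_smul, smul_zero,
    LinearMap.zero_apply]

end LabelledMatching

/-- Adjacency in the infinite Coxeter graph of type `D`. -/
def DAdj (i j : ℕ) : Prop :=
  (i = 0 ∧ j = 2) ∨ (j = 0 ∧ i = 2) ∨ (1 ≤ i ∧ 1 ≤ j ∧ (i + 1 = j ∨ j + 1 = i))

namespace LabelledMatching

/-- The position of the left end of the arc created by the `i`-th generator. -/
def pos (i : ℕ) : ℤ := max i 1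

/-- The label of the arc created by the `i`-th generator. -/
def lab (η : ZMod 2) (i : ℕ) : ZMod 2 := if i = 0 then η else 0

/-- The action of the `i`-th generator. -/
def act (η : ZMod 2) (i : ℕ) : Module.End (Polynomial ℤ) (LabelledMatching →₀ Polynomial ℤ) :=
  joinHom (pos i) (pos i + 1) (by omega) (lab η i)

theorem act_mul_self (η : ZMod 2) (i : ℕ) :
    act η i * act η i = (Polynomial.X : Polynomial ℤ) • act η i := joinHom_mul_self ..

theorem act_comm (η : ZMod 2) {i j : ℕ} (hne : i ≠ j) (h : ¬ DAdj i j) :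
    act η i * act η j = act η j * act η i := by
  unfold act
  by_cases h01 : pos i = pos j
  · have e : (i = 0 ∧ j = 1) ∨ (i = 1 ∧ j = 0) := by simp only [pos] at h01; omega
    by_cases hη : η = 0
    · rcases e with ⟨rfl, rfl⟩ | ⟨rfl, rfl⟩ <;> simp [lab, pos, hη]
    · simp only [h01]
      rw [joinHom_mul_of_ne, joinHom_mul_of_ne] <;>
      rcases e with ⟨rfl, rfl⟩ | ⟨rfl, rfl⟩ <;> simp [lab, hη, Ne.symm hη]
  · have : pos i + 1 ≠ pos j ∧ pos j + 1 ≠ pos i := by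
      simp only [pos, DAdj] at *; omega
    exact joinHom_comm _ _ h01 (by omega) (by omega) (by omega) _ _

theorem act_braid (η : ZMod 2) {i j : ℕ} (h : DAdj i j) :
    act η i * act η j * act η i = act η i := by
  unfold act
  have : pos i + 1 = pos j ∨ pos j + 1 = pos i := by
    simp only [pos, DAdj] at *; omega
  rcases this with h | h
  · simp only [← h]
    exact joinHom_braid _ _ (by omega) _ _
  · simp only [← h]
    rw [← joinHom_swap (pos j) (pos j + 1), ← joinHom_swap (pos j + 1) (pos j + 1 + 1)]
    exact joinHom_braid _ _ (by omega) _ _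

end LabelledMatching

open MulOpposite in
/-- The right action of `TL(Dₙ)` on labelled matchings. -/
def TLD.rep (η : ZMod 2) (n : ℕ) : TLD n →ₐ[Polynomial ℤ]
    (Module.End (Polynomial ℤ) (LabelledMatching →₀ Polynomial ℤ))ᵐᵒᵖ :=
  RingQuot.liftAlgHom (Polynomial ℤ)
    ⟨FreeAlgebra.lift (Polynomial ℤ) fun i : Fin n => op (LabelledMatching.act η i), by
      intro x y h
      induction h with
      | idem i => simp [← op_mul, LabelledMatching.act_mul_self]
      | comm i j hne h =>
        simpa [← op_mul] using (LabelledMatching.act_comm η (Fin.val_ne_of_ne hne) h).symm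
      | braid i j h =>
        simpa [← op_mul, mul_assoc] using LabelledMatching.act_braid η h⟩

/-- The quotient map from the free algebra onto `TL(Dₙ)`. -/
def TLD.mk (n : ℕ) : FreeAlgebra (Polynomial ℤ) (Fin n) →ₐ[Polynomial ℤ] TLD n :=
  RingQuot.mkAlgHom (Polynomial ℤ) (TLRel (Polynomial ℤ) Polynomial.X (DnAdj n))

theorem TLD.mk_surjective (n : ℕ) : Function.Surjective (TLD.mk n) :=
  RingQuot.mkAlgHom_surjective _ _

theorem TLD.mk_rel {n : ℕ} {x y : FreeAlgebra (Polynomial ℤ) (Fin n)}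
    (h : TLRel (Polynomial ℤ) Polynomial.X (DnAdj n) x y) : TLD.mk n x = TLD.mk n y :=
  RingQuot.mkAlgHom_rel _ h

/-- The generators of `TL(Dₙ)`, extended by zero. -/
def TLD.gen (n : ℕ) (i : ℕ) : TLD n :=
  if h : i < n then TLD.mk n (FreeAlgebra.ι _ (⟨i, h⟩ : Fin n)) else 0

theorem TLD.rep_gen (η : ZMod 2) {n i : ℕ} (hi : i < n) :
    TLD.rep η n (TLD.gen n i) = MulOpposite.op (LabelledMatching.act η i) := by
  rw [TLD.gen, dif_pos hi]
  refine (RingQuot.liftAlgHom_mkAlgHom_apply ..).trans ?_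
  simp

theorem TLD.gen_mul_self (n i : ℕ) :
    TLD.gen n i * TLD.gen n i = (Polynomial.X : Polynomial ℤ) • TLD.gen n i := by
  by_cases hi : i < n
  · simp only [TLD.gen, dif_pos hi]
    rw [← map_mul, ← map_smul]
    exact TLD.mk_rel (.idem _)
  · simp [TLD.gen, hi]

theorem TLD.gen_comm (n : ℕ) {i j : ℕ} (hne : i ≠ j) (h : ¬ DAdj i j) :
    TLD.gen n i * TLD.gen n j = TLD.gen n j * TLD.gen n i := by
  by_cases hi : i < n
  · by_cases hj : j < n
    · simp only [TLD.gen, dif_pos hi, dif_pos hj]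
      rw [← map_mul, ← map_mul]
      exact TLD.mk_rel (.comm _ _ (by simpa using hne) h)
    · simp [TLD.gen, hj]
  · simp [TLD.gen, hi]

theorem TLD.gen_braid {n i j : ℕ} (hi : i < n) (hj : j < n) (h : DAdj i j) :
    TLD.gen n i * TLD.gen n j * TLD.gen n i = TLD.gen n i := by
  simp only [TLD.gen, dif_pos hi, dif_pos hj]
  rw [← map_mul, ← map_mul]
  exact TLD.mk_rel (.braid _ _ h)

theorem TLD.eq_top_of_gen_mul_mem {n : ℕ} (S : Submodule (Polynomial ℤ) (TLD n)) (h1 : 1 ∈ S)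
    (hmul : ∀ i < n, ∀ x ∈ S, TLD.gen n i * x ∈ S) : S = ⊤ := by
  have key : ∀ a, ∀ x ∈ S, TLD.mk n a * x ∈ S := by
    intro a
    induction a using FreeAlgebra.induction with
    | grade0 r =>
      intro x hx
      rw [AlgHom.commutes, ← Algebra.smul_def]
      exact S.smul_mem r hx
    | grade1 i =>
      intro x hx
      have := hmul i i.2 x hx
      rwa [TLD.gen, dif_pos i.2] at this
    | mul a b ha hb =>
      intro x hx
      rw [map_mul, mul_assoc]
      exact ha _ (hb x hx)
    | add a b ha hb =>
      intro x hx
      rw [map_add, add_mul]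
      exact S.add_mem (ha x hx) (hb x hx)
  rw [eq_top_iff]
  intro y _
  obtain ⟨a, rfl⟩ := TLD.mk_surjective n y
  simpa using key a 1 h1

/-- A single rewriting step between words in the generators. -/
inductive WordStep : List ℕ → List ℕ → Prop
  | idem (p s : List ℕ) (i : ℕ) : WordStep (p ++ i :: i :: s) (p ++ i :: s)
  | comm (p s : List ℕ) (i j : ℕ) (hne : i ≠ j) (h : ¬ DAdj i j) :
      WordStep (p ++ i :: j :: s) (p ++ j :: i :: s)
  | braid (p s : List ℕ) (i j : ℕ) (h : DAdj i j) :
      WordStep (p ++ i :: j :: i :: s) (p ++ i :: s)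

/-- Iterated rewriting of words. -/
abbrev WordRed : List ℕ → List ℕ → Prop := Relation.ReflTransGen WordStep

theorem WordStep.append_left {u v : List ℕ} (h : WordStep u v) (p : List ℕ) :
    WordStep (p ++ u) (p ++ v) := by
  cases h with
  | idem q s i => simpa using WordStep.idem (p ++ q) s i
  | comm q s i j hne h => simpa using WordStep.comm (p ++ q) s i j hne h
  | braid q s i j h => simpa using WordStep.braid (p ++ q) s i j h

theorem WordStep.append_right {u v : List ℕ} (h : WordStep u v) (p : List ℕ) :
    WordStep (u ++ p) (v ++ p) := by
  cases h with
  | idem q s i => simpa using WordStep.idem q (s ++ p) i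
  | comm q s i j hne h => simpa using WordStep.comm q (s ++ p) i j hne h
  | braid q s i j h => simpa using WordStep.braid q (s ++ p) i j h

theorem WordStep.length_le {u v : List ℕ} (h : WordStep u v) : v.length ≤ u.length := by
  cases h <;> simp

theorem WordStep.subset {u v : List ℕ} (h : WordStep u v) : v ⊆ u := by
  cases h <;> intro x <;> simp <;> grind

theorem WordRed.append_left {u v : List ℕ} (h : WordRed u v) (p : List ℕ) :
    WordRed (p ++ u) (p ++ v) := h.lift (p ++ ·) fun _ _ h => h.append_left p

theorem WordRed.append_right {u v : List ℕ} (h : WordRed u v) (p : List ℕ) :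
    WordRed (u ++ p) (v ++ p) := h.lift (· ++ p) fun _ _ h => h.append_right p

theorem WordRed.length_le {u v : List ℕ} (h : WordRed u v) : v.length ≤ u.length := by
  induction h with
  | refl => rfl
  | tail _ h ih => exact h.length_le.trans ih

theorem WordRed.subset {u v : List ℕ} (h : WordRed u v) : v ⊆ u := by
  induction h with
  | refl => exact List.Subset.refl _
  | tail _ h ih => exact fun _ hx => ih (h.subset hx)

theorem WordRed.cons_comm (m : ℕ) (l : List ℕ) (h : ∀ x ∈ l, m ≠ x ∧ ¬ DAdj m x) :
    WordRed (m :: l) (l ++ [m]) := by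
  induction l with
  | nil => exact .refl
  | cons a l ih =>
    have h1 : WordRed (m :: a :: l) (a :: m :: l) :=
      .single (.comm [] l m a (h a (by simp)).1 (h a (by simp)).2)
    exact h1.trans ((ih fun x hx => h x (by simp [hx])).append_left [a])

theorem WordRed.concat_comm (m : ℕ) (l : List ℕ) (h : ∀ x ∈ l, x ≠ m ∧ ¬ DAdj x m) :
    WordRed (l ++ [m]) (m :: l) := by
  induction l with
  | nil => exact .refl
  | cons a l ih =>
    have h1 : WordRed (a :: m :: l) (m :: a :: l) :=
      .single (.comm [] l a m (h a (by simp)).1 (h a (by simp)).2)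
    exact ((ih fun x hx => h x (by simp [hx])).append_left [a]).trans h1

/-- The decreasing word `r, r - 1, …, j`. -/
def descWord (r j : ℕ) : List ℕ := (List.range' j (r + 1 - j)).reverse

theorem mem_descWord {r j x : ℕ} : x ∈ descWord r j ↔ j ≤ x ∧ x ≤ r := by
  simp [descWord, List.mem_range']
  constructor
  · rintro ⟨i, h, rfl⟩; omega
  · intro h; exact ⟨x - j, by omega, by omega⟩

theorem descWord_append {r j k : ℕ} (h1 : j ≤ k + 1) (h2 : k ≤ r) :
    descWord r j = descWord r (k + 1) ++ descWord k j := by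
  rw [descWord, descWord, descWord, ← List.reverse_append]
  congr 1
  have := List.range'_append (s := j) (m := k + 1 - j) (n := r + 1 - (k + 1)) (step := 1)
  rw [show j + 1 * (k + 1 - j) = k + 1 by omega,
    show k + 1 - j + (r + 1 - (k + 1)) = r + 1 - j by omega] at this
  exact this.symm

theorem descWord_self (j : ℕ) : descWord j j = [j] := by simp [descWord]

theorem descWord_of_lt {r j : ℕ} (h : r < j) : descWord r j = [] := by
  simp [descWord, show r + 1 - j = 0 by omega]

theorem descWord_concat {r j : ℕ} (h : j ≤ r) :
    descWord r j = descWord r (j + 1) ++ [j] := by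
  rw [descWord_append (by omega) h, descWord_self]

/-- The word with letters `r, r - 1, …, j`, where `0` is preceded by `2`. -/
def rowWord (r j : ℕ) : List ℕ := if j = 0 then descWord r 2 ++ [0] else descWord r j

theorem rowWord_zero (r : ℕ) : rowWord r 0 = descWord r 2 ++ [0] := by simp [rowWord]

theorem rowWord_pos {r j : ℕ} (h : 1 ≤ j) : rowWord r j = descWord r j := by
  simp [rowWord, show j ≠ 0 by omega]

theorem le_of_mem_rowWord {r j x : ℕ} (h : x ∈ rowWord r j) : x ≤ r := by
  unfold rowWord at h
  split at h
  · rw [List.mem_append, mem_descWord, List.mem_singleton] at h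
    omega
  · exact (mem_descWord.1 h).2

theorem mem_rowWord_right {r j : ℕ} (h : j ≤ r) : j ∈ rowWord r j := by
  unfold rowWord
  split
  · simp [*]
  · exact mem_descWord.2 ⟨le_rfl, h⟩

theorem mem_rowWord_left {r j : ℕ} (h : j ≤ r) (hr : 2 ≤ r) : r ∈ rowWord r j := by
  unfold rowWord
  split
  · simp [mem_descWord, hr]
  · exact mem_descWord.2 ⟨h, le_rfl⟩

/-- A word is shrinkable if it can be rewritten to a shorter one. -/
def WordShrinks (w : List ℕ) : Prop := ∃ w', WordRed w w' ∧ w'.length < w.length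

theorem WordShrinks.append_left {w : List ℕ} (h : WordShrinks w) (p : List ℕ) :
    WordShrinks (p ++ w) := by
  obtain ⟨w', h, hl⟩ := h
  exact ⟨p ++ w', h.append_left p, by simpa using hl⟩

theorem WordShrinks.append_right {w : List ℕ} (h : WordShrinks w) (p : List ℕ) :
    WordShrinks (w ++ p) := by
  obtain ⟨w', h, hl⟩ := h
  exact ⟨w' ++ p, h.append_right p, by simpa using hl⟩

theorem WordShrinks.of_red {u v : List ℕ} (h : WordRed u v) (hv : WordShrinks v) :
    WordShrinks u := by
  obtain ⟨w', h', hl⟩ := hv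
  exact ⟨w', h.trans h', hl.trans_le h.length_le⟩

theorem wordShrinks_idem (i : ℕ) : WordShrinks [i, i] :=
  ⟨[i], .single (.idem [] [] i), by simp⟩

theorem wordShrinks_braid {i j : ℕ} (h : DAdj i j) : WordShrinks [i, j, i] :=
  ⟨[i], .single (.braid [] [] i j h), by simp⟩

theorem wordShrinks_descWord_concat {r j m : ℕ} (hj : 1 ≤ j) (hjm : j < m) (hm : m ≤ r) :
    WordShrinks (descWord r j ++ [m]) := by
  obtain ⟨k, rfl⟩ : ∃ k, m = k + 1 := ⟨m - 1, by omega⟩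
  rw [descWord_append (show j ≤ k + 1 + 1 by omega) (show k + 1 ≤ r by omega), List.append_assoc]
  refine WordShrinks.append_left ?_ _
  rw [descWord_append (show j ≤ k + 1 by omega) (show k ≤ k + 1 by omega), descWord_self]
  obtain ⟨i, rfl⟩ : ∃ i, k = i + 1 := ⟨k - 1, by omega⟩
  rw [descWord_append (show j ≤ i + 1 by omega) (show i ≤ i + 1 by omega), descWord_self]
  have h1 : WordRed (descWord i j ++ [i + 1 + 1]) ([i + 1 + 1] ++ descWord i j) := by
    refine WordRed.concat_comm _ _ fun x hx => ?_
    rw [mem_descWord] at hx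
    unfold DAdj
    omega
  refine WordShrinks.of_red (v := [i + 1 + 1, i + 1, i + 1 + 1] ++ descWord i j) ?_ ?_
  · simpa using h1.append_left [i + 1 + 1, i + 1]
  · exact (wordShrinks_braid (by unfold DAdj; omega)).append_right _

theorem rowWord_concat {r j m : ℕ} (hr : 1 ≤ r) (hj : j ≤ r) (hm : m ≤ r) :
    WordShrinks (rowWord r j ++ [m]) ∨
    (∃ p s, WordRed (rowWord r j ++ [m]) (p ++ 1 :: 0 :: s)) ∨
    (∃ j' ≤ r, WordRed (rowWord r j ++ [m]) (rowWord r j')) ∨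
    (m < r ∧ 2 ≤ r ∧ WordRed (rowWord r j ++ [m]) ([m] ++ rowWord r j)) := by
  rcases Nat.eq_zero_or_pos j with rfl | hj0
  · rw [rowWord_zero]
    rcases (show m = 0 ∨ m = 1 ∨ m = 2 ∨ 3 ≤ m by omega) with rfl | rfl | rfl | hm3
    · left
      simpa using (wordShrinks_idem 0).append_left (descWord r 2)
    · right; left
      refine ⟨descWord r 2, [], ?_⟩
      rw [List.append_assoc]
      exact .single (.comm _ [] 0 1 (by simp) (by simp [DAdj]))
    · left
      rw [descWord_concat hm]
      simpa using (wordShrinks_braid (i := 2) (j := 0) (by simp [DAdj])).append_left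
        (descWord r 3)
    · left
      refine WordShrinks.of_red (v := descWord r 2 ++ [m] ++ [0]) ?_
        ((wordShrinks_descWord_concat (by omega) (by omega) hm).append_right _)
      rw [List.append_assoc, List.append_assoc]
      refine .single (.comm _ [] 0 m (by omega) ?_)
      unfold DAdj
      omega
  · rw [rowWord_pos hj0]
    rcases (show m = j ∨ j < m ∨ m < j by omega) with rfl | hjm | hmj
    · left
      rw [descWord_concat hm, List.append_assoc]
      exact (wordShrinks_idem m).append_left _
    · left
      exact wordShrinks_descWord_concat hj0 hjm hm
    · by_cases h10 : j = 1
      · obtain rfl : m = 0 := by omega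
        subst h10
        right; left
        refine ⟨descWord r 2, [], ?_⟩
        rw [descWord_concat hj, List.append_assoc]
        exact .refl
      · by_cases hadj : m + 1 = j ∨ (m = 0 ∧ j = 2)
        · right; right; left
          refine ⟨m, hm, ?_⟩
          rcases Nat.eq_zero_or_pos m with rfl | hm0
          · obtain rfl : j = 2 := by omega
            rw [rowWord_zero]
          · rw [rowWord_pos hm0, descWord_concat hm, show m + 1 = j by omega]
        · right; right; right
          refine ⟨by omega, by omega, ?_⟩
          refine WordRed.concat_comm _ _ fun x hx => ?_
          rw [mem_descWord] at hx
          unfold DAdj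
          omega

theorem wordShrinks_cons_descWord {r j k : ℕ} (hj : 1 ≤ j) (hjk : j ≤ k) (hkr : k < r) :
    WordShrinks (k :: descWord r j) := by
  rw [descWord_append (show j ≤ k + 1 + 1 by omega) (show k + 1 ≤ r by omega),
    descWord_append (show j ≤ k + 1 by omega) (show k ≤ k + 1 by omega), descWord_self]
  have h2 : ∃ l, descWord k j = k :: l := by
    rcases eq_or_lt_of_le hjk with rfl | h
    · exact ⟨[], descWord_self _⟩
    · obtain ⟨i, rfl⟩ : ∃ i, k = i + 1 := ⟨k - 1, by omega⟩
      exact ⟨descWord i j, by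
        rw [descWord_append (show j ≤ i + 1 by omega) (show i ≤ i + 1 by omega), descWord_self]
        rfl⟩
  obtain ⟨l, hl⟩ := h2
  have h1 : WordRed (k :: descWord r (k + 1 + 1)) (descWord r (k + 1 + 1) ++ [k]) := by
    refine WordRed.cons_comm _ _ fun x hx => ?_
    rw [mem_descWord] at hx
    unfold DAdj
    omega
  refine WordShrinks.of_red (h1.append_right _) ?_
  rw [List.append_assoc, hl]
  refine WordShrinks.append_left ?_ _
  exact (wordShrinks_braid (i := k) (j := k + 1) (by unfold DAdj; omega)).append_right l

theorem wordShrinks_cons_rowWord {r j k : ℕ} (hkr : k < r) (hr : 2 ≤ r)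
    (h : ¬ (k < j ∨ (k = 1 ∧ j = 0))) : WordShrinks (k :: rowWord r j) := by
  rcases Nat.eq_zero_or_pos j with rfl | hj0
  · rw [rowWord_zero]
    rcases Nat.eq_zero_or_pos k with rfl | hk0
    · have h1 : WordRed (0 :: descWord r 3) (descWord r 3 ++ [0]) := by
        refine WordRed.cons_comm _ _ fun x hx => ?_
        rw [mem_descWord] at hx
        unfold DAdj
        omega
      rw [descWord_concat hr, List.append_assoc]
      refine WordShrinks.of_red (h1.append_right [2, 0]) ?_
      rw [List.append_assoc]
      exact (wordShrinks_braid (i := 0) (j := 2) (by simp [DAdj])).append_left _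
    · exact (wordShrinks_cons_descWord (by omega) (by omega) hkr).append_right [0]
  · rw [rowWord_pos hj0]
    exact wordShrinks_cons_descWord hj0 (by omega) hkr

theorem exists_rowWord_eq_concat {r j : ℕ} (hj : j ≤ r) : ∃ l, rowWord r j = l ++ [j] := by
  rcases Nat.eq_zero_or_pos j with rfl | hj0
  · exact ⟨_, rowWord_zero r⟩
  · exact ⟨_, (rowWord_pos hj0).trans (descWord_concat hj)⟩

/-- The normal form condition on a list of rows, the last row coming first. -/
def IsNormal : List (ℕ × ℕ) → Prop
  | [] => True
  | x :: l => 1 ≤ x.1 ∧ x.2 ≤ x.1 ∧ IsNormal l ∧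
      ∀ y ∈ l.head?, y.1 < x.1 ∧ (y.2 < x.2 ∨ (y.2 = 1 ∧ x.2 = 0))

/-- The word described by a list of rows. -/
def rowsWord : List (ℕ × ℕ) → List ℕ
  | [] => []
  | x :: l => rowsWord l ++ rowWord x.1 x.2

theorem mem_rowsWord_of_mem_rowWord {l : List (ℕ × ℕ)} {x : ℕ × ℕ} (hx : x ∈ l) {i : ℕ}
    (hi : i ∈ rowWord x.1 x.2) : i ∈ rowsWord l := by
  induction l with
  | nil => simp at hx
  | cons y l ih =>
    rw [rowsWord, List.mem_append]
    rcases List.mem_cons.1 hx with rfl | hx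
    · exact .inr hi
    · exact .inl (ih hx)

theorem IsNormal.of_mem {l : List (ℕ × ℕ)} (hl : IsNormal l) {x : ℕ × ℕ} (hx : x ∈ l) :
    1 ≤ x.1 ∧ x.2 ≤ x.1 := by
  induction l with
  | nil => simp at hx
  | cons y l ih =>
    rcases List.mem_cons.1 hx with rfl | hx
    · exact ⟨hl.1, hl.2.1⟩
    · exact ih hl.2.2.1 hx

theorem IsNormal.fst_lt {x : ℕ × ℕ} {l : List (ℕ × ℕ)} (hl : IsNormal (x :: l)) {y : ℕ × ℕ}
    (hy : y ∈ l) : y.1 < x.1 := by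
  induction l generalizing x with
  | nil => simp at hy
  | cons z l ih =>
    have h := hl.2.2.2 z (by simp)
    rcases List.mem_cons.1 hy with rfl | hy
    · exact h.1
    · exact (ih hl.2.2.1 hy).trans h.1

theorem le_of_mem_rowsWord {x : ℕ × ℕ} {l : List (ℕ × ℕ)} (hl : IsNormal (x :: l)) {i : ℕ}
    (hi : i ∈ rowsWord l) : i < x.1 := by
  induction l generalizing x with
  | nil => simp [rowsWord] at hi
  | cons y l ih =>
    have h := hl.2.2.2 y (by simp)
    rcases List.mem_append.1 hi with hi | hi
    · exact (ih hl.2.2.1 hi).trans h.1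
    · exact (le_of_mem_rowWord hi).trans_lt h.1

theorem IsNormal.cons_or_wordShrinks {l : List (ℕ × ℕ)} (hl : IsNormal l) {r j : ℕ} (hr : 1 ≤ r)
    (hj : j ≤ r) (h : ∀ y ∈ l.head?, y.1 < r) :
    IsNormal ((r, j) :: l) ∨ WordShrinks (rowsWord l ++ rowWord r j) := by
  cases l with
  | nil => exact .inl ⟨hr, hj, hl, by simp⟩
  | cons y l =>
    have hy := h y (by simp)
    by_cases hc : y.2 < j ∨ (y.2 = 1 ∧ j = 0)
    · exact .inl ⟨hr, hj, hl, by simpa using ⟨hy, hc⟩⟩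
    · right
      obtain ⟨u, hu⟩ := exists_rowWord_eq_concat hl.2.1
      rw [rowsWord, hu, List.append_assoc, List.append_assoc]
      refine (WordShrinks.append_left ?_ u).append_left _
      exact wordShrinks_cons_rowWord (hl.2.1.trans_lt hy) (by have := hl.1; omega) hc

theorem exists_normal_wordRed (w : List ℕ) : (∃ l, IsNormal l ∧ WordRed w (rowsWord l)) ∨
    ∃ p s, WordRed w (p ++ 1 :: 0 :: s) := by
  induction hn : w.length using Nat.strong_induction_on generalizing w with
  | _ n ih =>
  have hshrink : ∀ v, v.length ≤ n → WordRed w v → WordShrinks v →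
      (∃ l, IsNormal l ∧ WordRed w (rowsWord l)) ∨ ∃ p s, WordRed w (p ++ 1 :: 0 :: s) := by
    rintro v hv hwv ⟨v', h, hlt⟩
    rcases ih _ (hlt.trans_le hv) v' rfl with ⟨l, hl, h'⟩ | ⟨p, s, h'⟩
    · exact .inl ⟨l, hl, (hwv.trans h).trans h'⟩
    · exact .inr ⟨p, s, (hwv.trans h).trans h'⟩
  rcases List.eq_nil_or_concat w with rfl | ⟨u, m, rfl⟩
  · exact .inl ⟨[], trivial, .refl⟩
  rw [List.concat_eq_append] at *
  have hu : u.length < n := by simp at hn; omega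
  rcases ih _ hu u rfl with ⟨l, hl, hul⟩ | ⟨p, s, h⟩
  swap
  · exact .inr ⟨p, s ++ [m], by simpa using h.append_right [m]⟩
  have hw := hul.append_right [m]
  have hwn := hw.length_le.trans hn.le
  have happ : ∀ l : List (ℕ × ℕ), IsNormal l → ∀ r j, 1 ≤ r → j ≤ r → (∀ y ∈ l.head?, y.1 < r) →
      WordRed (u ++ [m]) (rowsWord l ++ rowWord r j) →
      (∃ l, IsNormal l ∧ WordRed (u ++ [m]) (rowsWord l)) ∨
        ∃ p s, WordRed (u ++ [m]) (p ++ 1 :: 0 :: s) := by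
    intro l hl r j hr hj hlr hred
    rcases hl.cons_or_wordShrinks hr hj hlr with h | h
    · exact .inl ⟨_, h, hred⟩
    · exact hshrink _ (hred.length_le.trans hn.le) hred h
  cases l with
  | nil =>
    rcases Nat.eq_zero_or_pos m with rfl | hm
    · exact .inl ⟨[(1, 0)], ⟨by simp, by simp, trivial, by simp⟩, hw⟩
    · exact .inl ⟨[(m, m)], ⟨hm, le_rfl, trivial, by simp⟩, by
        simpa [rowsWord, rowWord_pos hm, descWord_self] using hw⟩
  | cons x l =>
    have hx1 := hl.1
    have hx2 := hl.2.1
    by_cases hm : x.1 < m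
    · refine happ _ hl m m (by omega) le_rfl (by simpa using hm) ?_
      rwa [rowWord_pos (by omega), descWord_self]
    · have hlx : ∀ y ∈ l.head?, y.1 < x.1 := fun y hy => (hl.2.2.2 y hy).1
      rw [rowsWord, List.append_assoc] at hw hwn
      rcases rowWord_concat hx1 hx2 (not_lt.1 hm) with h | ⟨p, s, h⟩ | ⟨j', hj', h⟩ | ⟨h1, h2, h⟩
      · exact hshrink _ hwn hw (h.append_left _)
      · exact .inr ⟨rowsWord l ++ p, s, by
          simpa using hw.trans (h.append_left (rowsWord l))⟩
      · exact happ l hl.2.2.1 x.1 j' hx1 hj' hlx (hw.trans (h.append_left _))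
      · have hw' := hw.trans (h.append_left (rowsWord l))
        rw [← List.append_assoc] at hw'
        have hlen := WordRed.length_le hw'
        have hne : 0 < (rowWord x.1 x.2).length :=
          List.length_pos_of_mem (mem_rowWord_right hx2)
        rcases ih _ (by simp at hlen hn ⊢; omega) (rowsWord l ++ [m]) rfl with
          ⟨l', hl', h'⟩ | ⟨p, s, h'⟩
        · refine happ l' hl' x.1 x.2 hx1 hx2 (fun y hy => ?_)
            (hw'.trans (h'.append_right _))
          have hy' := List.mem_of_mem_head? hy
          by_cases hy2 : 2 ≤ y.1
          · have := h'.subset (mem_rowsWord_of_mem_rowWord hy'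
              (mem_rowWord_left (hl'.of_mem hy').2 hy2))
            rcases List.mem_append.1 this with h3 | h3
            · exact le_of_mem_rowsWord hl h3
            · simp at h3; omega
          · omega
        · exact .inr ⟨p, s ++ rowWord x.1 x.2, by
            simpa using hw'.trans (h'.append_right (rowWord x.1 x.2))⟩

namespace TLD

variable {n : ℕ}

/-- The product of the generators along a word. -/
def wordProd (n : ℕ) (w : List ℕ) : TLD n := (w.map (gen n)).prod

theorem wordProd_nil : wordProd n [] = 1 := rfl

theorem wordProd_cons (i : ℕ) (w : List ℕ) : wordProd n (i :: w) = gen n i * wordProd n w := by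
  simp [wordProd]

theorem wordProd_append (v w : List ℕ) :
    wordProd n (v ++ w) = wordProd n v * wordProd n w := by
  simp [wordProd]

/-- The conjugates of the product of the two commuting generators `0` and `1`. -/
def fork (n : ℕ) : ℕ → TLD n
  | 0 => gen n 1 * gen n 0
  | 1 => gen n 1 * gen n 0
  | i + 2 => gen n (i + 2) * fork n (i + 1) * gen n (i + 2)

theorem fork_one : fork n 1 = gen n 1 * gen n 0 := rfl

theorem fork_succ {i : ℕ} (hi : 1 ≤ i) :
    fork n (i + 1) = gen n (i + 1) * fork n i * gen n (i + 1) := by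
  obtain ⟨k, rfl⟩ : ∃ k, i = k + 1 := ⟨i - 1, by omega⟩
  rfl

theorem gen_zero_mul_gen_one : gen n 0 * gen n 1 = gen n 1 * gen n 0 :=
  gen_comm n (by simp) (by simp [DAdj])

theorem exists_fork_eq_gen_mul {i : ℕ} (hi : 1 ≤ i) : ∃ y, fork n i = gen n i * y := by
  rcases eq_or_lt_of_le hi with rfl | h
  · exact ⟨_, rfl⟩
  · obtain ⟨k, rfl⟩ : ∃ k, i = k + 1 := ⟨i - 1, by omega⟩
    exact ⟨_, (fork_succ (by omega)).trans (mul_assoc ..)⟩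

theorem exists_fork_eq_mul_gen {i : ℕ} (hi : 1 ≤ i) : ∃ y, fork n i = y * gen n i := by
  rcases eq_or_lt_of_le hi with rfl | h
  · exact ⟨_, gen_zero_mul_gen_one.symm⟩
  · obtain ⟨k, rfl⟩ : ∃ k, i = k + 1 := ⟨i - 1, by omega⟩
    exact ⟨_, fork_succ (by omega)⟩

theorem gen_mul_fork_self {i : ℕ} (hi : 1 ≤ i) :
    gen n i * fork n i = (Polynomial.X : Polynomial ℤ) • fork n i := by
  obtain ⟨y, hy⟩ := exists_fork_eq_gen_mul (n := n) hi
  rw [hy, ← mul_assoc, gen_mul_self, smul_mul_assoc]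

theorem fork_mul_gen_self {i : ℕ} (hi : 1 ≤ i) :
    fork n i * gen n i = (Polynomial.X : Polynomial ℤ) • fork n i := by
  obtain ⟨y, hy⟩ := exists_fork_eq_mul_gen (n := n) hi
  rw [hy, mul_assoc, gen_mul_self, mul_smul_comm]

theorem gen_mul_gen_mul_fork {i j : ℕ} (hi : 1 ≤ i) (hin : i < n) (hjn : j < n) (h : DAdj i j) :
    gen n i * gen n j * fork n i = fork n i := by
  obtain ⟨y, hy⟩ := exists_fork_eq_gen_mul (n := n) hi
  rw [hy, ← mul_assoc, gen_braid hin hjn h]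

theorem fork_mul_gen_mul_gen {i j : ℕ} (hi : 1 ≤ i) (hin : i < n) (hjn : j < n) (h : DAdj i j) :
    fork n i * gen n j * gen n i = fork n i := by
  obtain ⟨y, hy⟩ := exists_fork_eq_mul_gen (n := n) hi
  rw [hy, mul_assoc, mul_assoc, ← mul_assoc (gen n i), gen_braid hin hjn h]

theorem commute_gen {i j : ℕ} (hne : i ≠ j) (h : ¬ DAdj i j) : Commute (gen n i) (gen n j) :=
  gen_comm n hne h

theorem commute_gen_fork {i j : ℕ} (hi : 1 ≤ i) (hij : i + 2 ≤ j) :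
    Commute (gen n j) (fork n i) := by
  have hc : ∀ k, k + 2 ≤ j → 3 ≤ j → Commute (gen n j) (gen n k) := fun k hk h3 =>
    commute_gen (by omega) (by unfold DAdj; omega)
  induction i, hi using Nat.le_induction with
  | base => exact (hc 1 hij hij).mul_right (hc 0 (by omega) hij)
  | succ i hi ih =>
    rw [fork_succ hi]
    exact ((hc _ hij (by omega)).mul_right (ih (by omega))).mul_right (hc _ hij (by omega))

theorem gen_mul_fork {i j : ℕ} (hi : 1 ≤ i) (hj : 1 ≤ j) (hin : i < n) (hjn : j < n) :
    gen n i * fork n j = fork n i * gen n j := by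
  have hup : ∀ i, 1 ≤ i → ∀ (_ : i + 1 < n),
      gen n i * fork n (i + 1) = fork n i * gen n (i + 1) := by
    intro i hi hin
    rw [fork_succ hi, ← mul_assoc, ← mul_assoc,
      gen_mul_gen_mul_fork hi (by omega) hin (by unfold DAdj; omega)]
  have hdown : ∀ i, 1 ≤ i → ∀ (_ : i + 1 < n),
      gen n (i + 1) * fork n i = fork n (i + 1) * gen n i := by
    intro i hi hin
    rw [fork_succ hi, mul_assoc, mul_assoc, ← mul_assoc (fork n i),
      fork_mul_gen_mul_gen hi (by omega) hin (by unfold DAdj; omega)]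
  rcases lt_trichotomy i j with h | rfl | h
  · induction j, h using Nat.le_induction with
    | base => exact hup i hi hjn
    | succ j hij ih =>
      have h1 : Commute (gen n i) (gen n (j + 1)) :=
        commute_gen (by omega) (by unfold DAdj; omega)
      have h2 : Commute (gen n (j + 1)) (fork n i) := commute_gen_fork hi (by omega)
      have h3 := gen_braid (n := n) hjn (show j < n by omega) (by unfold DAdj; omega)
      rw [fork_succ (by omega), ← mul_assoc, ← mul_assoc, h1.eq, mul_assoc (gen n (j + 1)),
        ih (by omega) (by omega), ← mul_assoc, h2.eq, mul_assoc, mul_assoc,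
        ← mul_assoc (gen n (j + 1)), h3]
  · rw [gen_mul_fork_self hi, fork_mul_gen_self hi]
  · induction i, h using Nat.le_induction with
    | base => exact hdown j hj hin
    | succ i hij ih =>
      have h1 : Commute (gen n (i + 1)) (gen n j) :=
        commute_gen (by omega) (by unfold DAdj; omega)
      have h2 : Commute (gen n (i + 1)) (fork n j) := commute_gen_fork hj (by omega)
      have h3 := gen_braid (n := n) hin (show i < n by omega) (by unfold DAdj; omega)
      rw [fork_succ (by omega), mul_assoc, h1.eq, mul_assoc, ← mul_assoc (fork n i),
        ← ih (by omega) (by omega), mul_assoc, ← h2.eq, ← mul_assoc, ← mul_assoc, h3]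

theorem fork_mul_gen_comm {i j : ℕ} (hi : 1 ≤ i) (hj : 1 ≤ j) (hin : i < n) (hjn : j < n)
    (hne : i ≠ j) (h : ¬ DAdj i j) : fork n i * gen n j = fork n j * gen n i := by
  unfold DAdj at h
  rcases lt_or_gt_of_ne hne with hlt | hlt
  · rw [← (commute_gen_fork hi (show i + 2 ≤ j by omega)).eq, gen_mul_fork hj hi hjn hin]
  · rw [← (commute_gen_fork hj (show j + 2 ≤ i by omega)).eq, gen_mul_fork hi hj hin hjn]

theorem gen_zero_mul_fork {j : ℕ} (hj : 1 ≤ j) (hjn : j < n) :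
    gen n 0 * fork n j = gen n 1 * fork n j := by
  induction j, hj using Nat.le_induction with
  | base =>
    rw [gen_mul_fork_self le_rfl, fork_one, ← gen_zero_mul_gen_one, ← mul_assoc, gen_mul_self,
      smul_mul_assoc]
  | succ j hj ih =>
    rw [fork_succ hj]
    rcases eq_or_lt_of_le hj with rfl | h2
    · have h0 := gen_braid (n := n) (i := 0) (j := 2) (by omega) (by omega) (by simp [DAdj])
      have h1 := gen_braid (n := n) (i := 1) (j := 2) (by omega) (by omega) (by simp [DAdj])
      have h2 : gen n 0 * (gen n 2 * fork n 1) = gen n 1 * (gen n 2 * fork n 1) := by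
        rw [fork_one]
        nth_rw 1 [← gen_zero_mul_gen_one]
        rw [← mul_assoc, ← mul_assoc, h0, ← mul_assoc, ← mul_assoc, h1, gen_zero_mul_gen_one]
      rw [← mul_assoc, ← mul_assoc (gen n 1), h2]
    · have h0 : Commute (gen n 0) (gen n (j + 1)) :=
        commute_gen (by omega) (by unfold DAdj; omega)
      have h1 : Commute (gen n 1) (gen n (j + 1)) :=
        commute_gen (by omega) (by unfold DAdj; omega)
      rw [mul_assoc (gen n (j + 1)), ← mul_assoc (gen n 0), ← mul_assoc (gen n 1), h0.eq, h1.eq,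
        mul_assoc, mul_assoc, ← mul_assoc (gen n 0), ih (by omega), ← mul_assoc (gen n 1)]

theorem fork_mul_gen_zero {j : ℕ} (hj : 1 ≤ j) (hjn : j < n) :
    fork n j * gen n 0 = fork n j * gen n 1 := by
  induction j, hj using Nat.le_induction with
  | base => rw [fork_mul_gen_self le_rfl, fork_one, mul_assoc, gen_mul_self, mul_smul_comm]
  | succ j hj ih =>
    rw [fork_succ hj]
    rcases eq_or_lt_of_le hj with rfl | h2
    · have h0 := gen_braid (n := n) (i := 0) (j := 2) (by omega) (by omega) (by simp [DAdj])
      have h1 := gen_braid (n := n) (i := 1) (j := 2) (by omega) (by omega) (by simp [DAdj])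
      simp only [mul_assoc] at h0 h1 ⊢
      rw [fork_one, mul_assoc, h0, ← gen_zero_mul_gen_one, mul_assoc, h1]
    · have h0 : Commute (gen n 0) (gen n (j + 1)) :=
        commute_gen (by omega) (by unfold DAdj; omega)
      have h1 : Commute (gen n 1) (gen n (j + 1)) :=
        commute_gen (by omega) (by unfold DAdj; omega)
      rw [mul_assoc, ← h0.eq, mul_assoc, mul_assoc, ← mul_assoc (fork n j), ih (by omega),
        mul_assoc (fork n j), h1.eq, mul_assoc]

/-- The product along a word, the generator of the first letter being replaced by the
corresponding `fork`. -/
def forkProd (n : ℕ) : List ℕ → TLD n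
  | [] => 0
  | i :: w => fork n i * wordProd n w

theorem forkProd_cons (i : ℕ) (w : List ℕ) : forkProd n (i :: w) = fork n i * wordProd n w := rfl

/-- The ideal generated by the product of the generators `0` and `1`. -/
def forkIdeal (n : ℕ) : Submodule (Polynomial ℤ) (TLD n) :=
  Submodule.span _ (forkProd n '' {w | ∀ i ∈ w, 1 ≤ i ∧ i < n})

theorem forkProd_mem {w : List ℕ} (h : ∀ i ∈ w, 1 ≤ i ∧ i < n) : forkProd n w ∈ forkIdeal n :=
  Submodule.subset_span ⟨w, h, rfl⟩

theorem gen_mul_mem_forkIdeal (hn : 1 < n) {i : ℕ} (hi : i < n) {x : TLD n}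
    (hx : x ∈ forkIdeal n) : gen n i * x ∈ forkIdeal n := by
  induction hx using Submodule.span_induction with
  | zero => simp
  | add x y _ _ hx hy => rw [mul_add]; exact add_mem hx hy
  | smul c x _ hx => rw [mul_smul_comm]; exact Submodule.smul_mem _ _ hx
  | mem x hx =>
    obtain ⟨w, hw, rfl⟩ := hx
    cases w with
    | nil => simp [forkProd]
    | cons j w =>
      have hj := hw j (by simp)
      have key : ∀ i, 1 ≤ i → i < n → gen n i * forkProd n (j :: w) ∈ forkIdeal n := by
        intro i hi hin
        rw [forkProd_cons, ← mul_assoc, gen_mul_fork hi hj.1 hin hj.2, mul_assoc, ← wordProd_cons,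
          ← forkProd_cons]
        refine forkProd_mem fun k hk => ?_
        rcases List.mem_cons.1 hk with rfl | hk
        · exact ⟨hi, hin⟩
        · exact hw k hk
      rcases Nat.eq_zero_or_pos i with rfl | hi0
      · rw [forkProd_cons, ← mul_assoc, gen_zero_mul_fork hj.1 hj.2, mul_assoc, ← forkProd_cons]
        exact key 1 le_rfl hn
      · exact key i hi0 hi

theorem fork_mul_wordProd_mul_gen_zero {i : ℕ} {w : List ℕ} (hi : 1 ≤ i ∧ i < n)
    (h : ∀ i ∈ w, 1 ≤ i ∧ i < n) :
    fork n i * wordProd n w * gen n 0 = fork n i * wordProd n w * gen n 1 := by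
  induction w generalizing i with
  | nil => simpa [wordProd_nil] using fork_mul_gen_zero hi.1 hi.2
  | cons j w ih =>
    have hj := h j (by simp)
    rw [wordProd_cons, ← mul_assoc, ← gen_mul_fork hi.1 hj.1 hi.2 hj.2, mul_assoc (gen n i),
      mul_assoc (gen n i), mul_assoc (gen n i), ih hj fun k hk => h k (by simp [hk])]

theorem mul_gen_mem_forkIdeal (hn : 1 < n) {i : ℕ} (hi : i < n) {x : TLD n}
    (hx : x ∈ forkIdeal n) : x * gen n i ∈ forkIdeal n := by
  induction hx using Submodule.span_induction with
  | zero => simp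
  | add x y _ _ hx hy => rw [add_mul]; exact add_mem hx hy
  | smul c x _ hx => rw [smul_mul_assoc]; exact Submodule.smul_mem _ _ hx
  | mem x hx =>
    obtain ⟨w, hw, rfl⟩ := hx
    cases w with
    | nil => simp [forkProd]
    | cons j w =>
      have key : ∀ i, 1 ≤ i → i < n → forkProd n (j :: w) * gen n i ∈ forkIdeal n := by
        intro i hi hin
        have h1 : forkProd n (j :: w) * gen n i = forkProd n (j :: (w ++ [i])) := by
          simp [forkProd_cons, wordProd_append, wordProd_cons, wordProd_nil, mul_assoc]
        rw [h1]
        refine forkProd_mem fun k hk => ?_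
        rw [← List.cons_append, List.mem_append, List.mem_singleton] at hk
        rcases hk with hk | rfl
        · exact hw k hk
        · exact ⟨hi, hin⟩
      rcases Nat.eq_zero_or_pos i with rfl | hi0
      · rw [forkProd_cons, fork_mul_wordProd_mul_gen_zero (hw j (by simp))
          (fun k hk => hw k (by simp [hk])), ← forkProd_cons]
        exact key 1 le_rfl hn
      · exact key i hi0 hi

theorem wordProd_mem_forkIdeal {p s : List ℕ} (h : ∀ i ∈ p ++ 1 :: 0 :: s, i < n) :
    wordProd n (p ++ 1 :: 0 :: s) ∈ forkIdeal n := by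
  have hn : 1 < n := h 1 (by simp)
  have hs : ∀ s : List ℕ, (∀ i ∈ s, i < n) → ∀ x ∈ forkIdeal n, x * wordProd n s ∈ forkIdeal n := by
    intro s
    induction s with
    | nil => simp [wordProd_nil]
    | cons i s ih =>
      intro h x hx
      rw [wordProd_cons, ← mul_assoc]
      exact ih (fun k hk => h k (by simp [hk])) _ (mul_gen_mem_forkIdeal hn (h i (by simp)) hx)
  induction p with
  | nil =>
    rw [List.nil_append, wordProd_cons, wordProd_cons, ← mul_assoc]
    refine hs s (fun i hi => h i (by simp [hi])) _ ?_
    have := forkProd_mem (n := n) (w := [1]) (by simpa using hn)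
    simpa [forkProd_cons, wordProd_nil, fork_one] using this
  | cons i p ih =>
    rw [List.cons_append, wordProd_cons]
    exact gen_mul_mem_forkIdeal hn (h i (by simp)) (ih fun k hk => h k (by
      rw [List.cons_append]; exact List.mem_cons_of_mem _ hk))

theorem exists_wordProd_eq_smul_of_step {u v : List ℕ} (h : WordStep u v) (hu : ∀ i ∈ u, i < n) :
    ∃ c : Polynomial ℤ, wordProd n u = c • wordProd n v := by
  cases h with
  | idem p s i =>
    refine ⟨Polynomial.X, ?_⟩
    simp only [wordProd_append, wordProd_cons]
    rw [← mul_assoc (gen n i), gen_mul_self, smul_mul_assoc, mul_smul_comm]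
  | comm p s i j hne h =>
    refine ⟨1, ?_⟩
    simp only [wordProd_append, wordProd_cons]
    rw [← mul_assoc (gen n i), gen_comm n hne h, mul_assoc, one_smul]
  | braid p s i j h =>
    refine ⟨1, ?_⟩
    simp only [wordProd_append, wordProd_cons]
    rw [← mul_assoc (gen n j), ← mul_assoc (gen n i), ← mul_assoc (gen n i),
      gen_braid (hu i (by simp)) (hu j (by simp)) h, one_smul]

theorem exists_forkProd_eq_smul_of_step {u v : List ℕ} (h : WordStep u v)
    (hu : ∀ i ∈ u, 1 ≤ i ∧ i < n) : ∃ c : Polynomial ℤ, forkProd n u = c • forkProd n v := by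
  have key : ∀ m u v, WordStep u v → (∀ i ∈ m :: u, 1 ≤ i ∧ i < n) →
      ∃ c : Polynomial ℤ, forkProd n (m :: u) = c • forkProd n (m :: v) := by
    intro m u v h hu
    obtain ⟨c, hc⟩ := exists_wordProd_eq_smul_of_step h fun i hi => (hu i (by simp [hi])).2
    exact ⟨c, by rw [forkProd_cons, hc, mul_smul_comm, forkProd_cons]⟩
  cases h with
  | idem p s i =>
    cases p with
    | cons m p => exact key m _ _ (.idem p s i) hu
    | nil =>
      refine ⟨Polynomial.X, ?_⟩
      simp only [List.nil_append, forkProd_cons, wordProd_cons]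
      rw [← mul_assoc, fork_mul_gen_self (hu i (by simp)).1, smul_mul_assoc]
  | comm p s i j hne h =>
    cases p with
    | cons m p => exact key m _ _ (.comm p s i j hne h) hu
    | nil =>
      refine ⟨1, ?_⟩
      have hi := hu i (by simp)
      have hj := hu j (by simp)
      simp only [List.nil_append, forkProd_cons, wordProd_cons]
      rw [← mul_assoc, fork_mul_gen_comm hi.1 hj.1 hi.2 hj.2 hne h, mul_assoc, one_smul]
  | braid p s i j h =>
    cases p with
    | cons m p => exact key m _ _ (.braid p s i j h) hu
    | nil =>
      refine ⟨1, ?_⟩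
      have hi := hu i (by simp)
      have hj := hu j (by simp)
      simp only [List.nil_append, forkProd_cons, wordProd_cons]
      rw [← mul_assoc, ← mul_assoc, fork_mul_gen_mul_gen hi.1 hi.2 hj.2 h, one_smul]

theorem exists_wordProd_eq_smul {u v : List ℕ} (h : WordRed u v) (hu : ∀ i ∈ u, i < n) :
    ∃ c : Polynomial ℤ, wordProd n u = c • wordProd n v := by
  induction h with
  | refl => exact ⟨1, (one_smul _ _).symm⟩
  | tail h h' ih =>
    obtain ⟨c, hc⟩ := ih
    obtain ⟨d, hd⟩ := exists_wordProd_eq_smul_of_step (n := n) h'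
      fun i hi => hu i (WordRed.subset h hi)
    exact ⟨c * d, by rw [hc, hd, smul_smul]⟩

theorem exists_forkProd_eq_smul {u v : List ℕ} (h : WordRed u v) (hu : ∀ i ∈ u, 1 ≤ i ∧ i < n) :
    ∃ c : Polynomial ℤ, forkProd n u = c • forkProd n v := by
  induction h with
  | refl => exact ⟨1, (one_smul _ _).symm⟩
  | tail h h' ih =>
    obtain ⟨c, hc⟩ := ih
    obtain ⟨d, hd⟩ := exists_forkProd_eq_smul_of_step (n := n) h'
      fun i hi => hu i (WordRed.subset h hi)
    exact ⟨c * d, by rw [hc, hd, smul_smul]⟩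

end TLD

/-- The normal forms with rows below `n` whose ends are at least `m`. -/
def normalForms (m n : ℕ) : Set (List (ℕ × ℕ)) :=
  {l | IsNormal l ∧ ∀ x ∈ l, x.1 < n ∧ m ≤ x.2}

theorem IsNormal.mem_normalForms {m n : ℕ} {l : List (ℕ × ℕ)} (hl : IsNormal l) (hn : 1 < n)
    (h : ∀ i ∈ rowsWord l, m ≤ i ∧ i < n) : l ∈ normalForms m n := by
  refine ⟨hl, fun x hx => ?_⟩
  have hx' := hl.of_mem hx
  refine ⟨?_, (h _ (mem_rowsWord_of_mem_rowWord hx (mem_rowWord_right hx'.2))).1⟩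
  by_cases h2 : 2 ≤ x.1
  · exact (h _ (mem_rowsWord_of_mem_rowWord hx (mem_rowWord_left hx'.2 h2))).2
  · omega

namespace TLD

variable {n : ℕ}

/-- The spanning family of `TL(Dₙ)`. -/
def family (n : ℕ) : normalForms 0 n ⊕ {l // l ∈ normalForms 1 n ∧ l ≠ []} → TLD n :=
  Sum.elim (fun l => wordProd n (rowsWord l)) fun l => forkProd n (rowsWord l)

theorem span_range_family (hn : 1 < n) :
    Submodule.span (Polynomial ℤ) (Set.range (family n)) = ⊤ := by
  have hfork : forkIdeal n ≤ Submodule.span (Polynomial ℤ) (Set.range (family n)) := by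
    refine Submodule.span_le.2 ?_
    rintro _ ⟨w, hw, rfl⟩
    rcases exists_normal_wordRed w with ⟨l, hl, h⟩ | ⟨p, s, h⟩
    · obtain ⟨c, hc⟩ := exists_forkProd_eq_smul h hw
      rw [hc]
      by_cases h0 : l = []
      · simp [h0, rowsWord, forkProd]
      · refine Submodule.smul_mem _ _ (Submodule.subset_span ⟨.inr ⟨l, ?_, h0⟩, rfl⟩)
        exact hl.mem_normalForms hn fun i hi => hw i (WordRed.subset h hi)
    · have := (hw 0 (WordRed.subset h (by simp))).1
      omega
  have hword : ∀ w : List ℕ, (∀ i ∈ w, i < n) →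
      wordProd n w ∈ Submodule.span (Polynomial ℤ) (Set.range (family n)) := by
    intro w hw
    rcases exists_normal_wordRed w with ⟨l, hl, h⟩ | ⟨p, s, h⟩
    · obtain ⟨c, hc⟩ := exists_wordProd_eq_smul h hw
      rw [hc]
      refine Submodule.smul_mem _ _ (Submodule.subset_span ⟨.inl ⟨l, ?_⟩, rfl⟩)
      exact hl.mem_normalForms hn fun i hi => ⟨by omega, hw i (WordRed.subset h hi)⟩
    · obtain ⟨c, hc⟩ := exists_wordProd_eq_smul h hw
      rw [hc]
      exact Submodule.smul_mem _ _ (hfork (wordProd_mem_forkIdeal fun i hi =>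
        hw i (WordRed.subset h hi)))
  have htop : Submodule.span (Polynomial ℤ) (wordProd n '' {w | ∀ i ∈ w, i < n}) = ⊤ := by
    refine eq_top_of_gen_mul_mem _ (Submodule.subset_span ⟨[], by simp, rfl⟩) fun i hi x hx => ?_
    induction hx using Submodule.span_induction with
    | zero => simp
    | add x y _ _ hx hy => rw [mul_add]; exact add_mem hx hy
    | smul c x _ hx => rw [mul_smul_comm]; exact Submodule.smul_mem _ _ hx
    | mem x hx =>
      obtain ⟨w, hw, rfl⟩ := hx
      refine Submodule.subset_span ⟨i :: w, ?_, wordProd_cons i w⟩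
      simpa using ⟨hi, hw⟩
  rw [eq_top_iff, ← htop, Submodule.span_le]
  rintro _ ⟨w, hw, rfl⟩
  exact hword w hw

end TLD

namespace LabelledMatching

/-- `Reaches η w s t` means that the generators along `w` transform `s` into `t` without ever
creating a closed loop. -/
inductive Reaches (η : ZMod 2) (s : LabelledMatching) : List ℕ → LabelledMatching → Prop
  | nil : Reaches η s [] s
  | concat {w : List ℕ} {t : LabelledMatching} (i : ℕ) (h : Reaches η s w t)
      (hi : t.partner (pos i) ≠ pos i + 1) :
      Reaches η s (w ++ [i]) (t.join (pos i) (pos i + 1) (by omega) (lab η i))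

theorem Reaches.append {η : ZMod 2} {s t u : LabelledMatching} {v w : List ℕ}
    (h : Reaches η s v t) (h' : Reaches η t w u) : Reaches η s (v ++ w) u := by
  induction h' with
  | nil => simpa using h
  | concat i h' hi ih =>
    rw [← List.append_assoc]
    exact ih.concat i hi

theorem Reaches.of_zero_notMem {η η' : ZMod 2} {s t : LabelledMatching} {w : List ℕ}
    (h : Reaches η s w t) (hw : 0 ∉ w) : Reaches η' s w t := by
  induction h with
  | nil => exact .nil
  | concat i h hi ih =>
    rw [List.mem_append, not_or, List.mem_singleton] at hw
    have : lab η i = lab η' i := by simp [lab, Ne.symm hw.2]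
    simp only [this]
    exact (ih hw.1).concat i hi

/-- The displacement of the end points of arcs caused by the row `r, r - 1, …, k`. -/
def shift (r k y : ℤ) : ℤ := if y = r then -r - 2 else if k ≤ y ∧ y < r then y + 2 else y

/-- `IsRow r k ε s t` describes the effect `t` on `s` of the row `r, r - 1, …, k`, where the last
arc carries the label `ε`. -/
structure IsRow (r k : ℤ) (ε : ZMod 2) (s t : LabelledMatching) : Prop where
  partner_eq : t.partner k = k + 1
  label_eq : t.label k = ε
  partner_shift : ∀ y, y ≠ r + 1 → y ≠ -r - 2 → t.partner (shift r k y) = shift r k (s.partner y)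
  label_shift : ∀ y, y ≠ r + 1 → y ≠ -r - 2 →
    t.label (shift r k y) = s.label y + if y = k ∨ s.partner y = k then ε else 0

/-- Beyond `m`, all arcs are vertical and unlabelled. -/
def IsStraight (m : ℤ) (s : LabelledMatching) : Prop :=
  ∀ x, m ≤ x → s.partner x = -1 - x ∧ s.label x = 0

theorem IsStraight.mono {m m' : ℤ} {s : LabelledMatching} (h : s.IsStraight m) (hm : m ≤ m') :
    s.IsStraight m' := fun x hx => h x (hm.trans hx)

theorem isRow_join {r : ℤ} (hr : 1 ≤ r) (ε : ZMod 2) {s : LabelledMatching}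
    (hs : s.IsStraight (r + 1)) : IsRow r r ε s (s.join r (r + 1) (by omega) ε) := by
  have h0 := hs (r + 1) le_rfl
  have h1 := s.partner_partner
  have h2 := s.partner_ne
  have h3 := s.label_partner
  refine ⟨join_partner_left .., join_label_left .., fun y h h' => ?_, fun y h h' => ?_⟩
  · simp only [join, shift]
    grind
  · simp only [join, shift]
    grind

theorem IsRow.join {r k : ℤ} (hk : 1 ≤ k) (hkr : k + 1 ≤ r) (ε : ZMod 2) {s t : LabelledMatching}
    (hs : s.IsStraight (r + 1)) (h : IsRow r (k + 1) 0 s t) :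
    IsRow r k ε s (t.join k (k + 1) (by omega) ε) := by
  have h0 := hs (r + 1) le_rfl
  have h1 := s.partner_partner
  have h2 := s.partner_ne
  have h3 := s.label_partner
  obtain ⟨ha, hb, hc, hd⟩ := h
  have hck := hc k (by omega) (by omega)
  have hdk := hd k (by omega) (by omega)
  have hk' : shift r (k + 1) k = k := by simp only [shift]; grind
  rw [hk'] at hck hdk
  have hpk : s.partner k ≠ r + 1 ∧ s.partner k ≠ - r - 2 := by grind
  have hinj : ∀ y, y ≠ r + 1 → y ≠ -r - 2 →
      shift r (k + 1) y = shift r (k + 1) (s.partner k) → y = s.partner k := by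
    intro y; simp only [shift]; grind
  have hrange : ∀ y, y ≠ r + 1 → y ≠ -r - 2 →
      shift r (k + 1) y ≠ k + 1 ∧ shift r (k + 1) y ≠ k + 2 := by
    intro y; simp only [shift]; grind
  have hne : ∀ y, y ≠ k → shift r (k + 1) y = shift r k y ∧ shift r (k + 1) y ≠ k := by
    intro y; simp only [shift]; grind
  have hkk : shift r k k = k + 2 := by simp only [shift]; grind
  have hlk : t.label (k + 1) = 0 := hb
  have hpp : t.partner (k + 1) = k + 2 := by rw [ha]; ring
  have hl2 : t.label (k + 2) = 0 := by rw [← hpp, t.label_partner, hb]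
  have e1 : shift r (k + 1) (s.partner k) = shift r k (s.partner k) := (hne _ (h2 k)).1
  refine ⟨join_partner_left .., join_label_left .., fun y h h' => ?_, fun y h h' => ?_⟩
  · by_cases hy : y = k
    · subst hy
      simp only [LabelledMatching.join, hkk, hpp, hck]
      grind
    · by_cases hy' : y = s.partner k
      · subst hy'
        rw [h1, hkk, ← e1, ← hck]
        simp only [LabelledMatching.join, hpp]
        have := t.partner_ne k
        have := t.partner_partner
        grind
      · have h4 := hc y h h'
        have h5 := hne (s.partner y) (by grind)
        rw [← (hne y hy).1, ← h5.1]
        have h6 := hrange y h h'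
        simp only [LabelledMatching.join, hpp]
        grind
  · by_cases hy : y = k
    · subst hy
      simp only [LabelledMatching.join, hkk, hpp]
      grind
    · by_cases hy' : y = s.partner k
      · subst hy'
        rw [h1, ← e1, ← hck]
        simp only [LabelledMatching.join, hpp]
        have := t.partner_ne k
        have := t.partner_partner
        grind
      · have h4 := hd y h h'
        rw [← (hne y hy).1]
        have h6 := hrange y h h'
        simp only [LabelledMatching.join, hpp]
        grind

theorem IsRow.isStraight {r k : ℤ} {ε : ZMod 2} {s t : LabelledMatching} (hk : 1 ≤ k) (hkr : k ≤ r)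
    (hs : s.IsStraight (r + 1)) (h : IsRow r k ε s t) : t.IsStraight (r + 2) := by
  intro x hx
  have h1 := hs x (by omega)
  have h2 := h.partner_shift x (by omega) (by omega)
  have h3 := h.label_shift x (by omega) (by omega)
  simp only [shift] at h2 h3
  grind

theorem IsRow.label_ne_zero {r k : ℤ} {ε : ZMod 2} {s t : LabelledMatching} (hk : 1 ≤ k)
    (h : IsRow r k ε s t)
    (hs : ∀ y, k ≤ y → y < r → s.partner y = y + 1 → s.label y + (if y = k then ε else 0) ≠ 0)
    {y : ℤ} (hy : k ≤ y) (hyr : y < r) (hsy : s.partner y = y + 1) : t.label (y + 2) ≠ 0 := by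
  have h3 := h.label_shift y (by omega) (by omega)
  have h4 := hs y hy hyr hsy
  simp only [shift] at h3
  grind

theorem IsRow.not_straight {r k : ℤ} {ε : ZMod 2} {s t : LabelledMatching} (hk : 1 ≤ k)
    (hkr : k ≤ r) (h : IsRow r k ε s t) (hst : s.IsStraight (r + 1))
    (hs : ∀ y, k ≤ y → y < r → s.partner y = y + 1 → s.label y + (if y = k then ε else 0) ≠ 0) :
    ¬ t.IsStraight (r + 1) := by
  intro ht
  have ht := ht (r + 1) le_rfl
  rcases eq_or_lt_of_le hkr with rfl | hlt
  · have := h.partner_eq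
    have := t.partner_partner k
    grind
  · have h2 := h.partner_shift (r - 1) (by omega) (by omega)
    have h5 := hst (r + 1) le_rfl
    have h6 := s.partner_partner
    have h7 : s.partner (r - 1) = r - 1 + 1 := by
      simp only [shift] at h2
      grind
    have := h.label_ne_zero hk hs (y := r - 1) (by omega) (by omega) h7
    grind

theorem IsRow.label_ne_zero_of_lt {r k : ℤ} {ε : ZMod 2} {s t : LabelledMatching} (hk : 1 ≤ k)
    (hkr : k ≤ r) (h : IsRow r k ε s t) (hst : s.IsStraight (r + 1))
    (hs : ∀ y, k ≤ y → y < r → s.partner y = y + 1 → s.label y + (if y = k then ε else 0) ≠ 0)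
    {x : ℤ} (hx : k < x) (htx : t.partner x = x + 1) : t.label x ≠ 0 := by
  have ht := h.isStraight hk hkr hst
  have hxr : x ≤ r + 1 := by
    by_contra! hc
    have := ht x (by omega)
    grind
  have hxk : x ≠ k + 1 := by
    rintro rfl
    have := h.partner_eq
    have := t.partner_partner k
    grind
  have h2 := h.partner_shift (x - 2) (by omega) (by omega)
  have h5 := hst (r + 1) le_rfl
  have h5' := hst (r + 2) (by omega)
  have h6 := s.partner_partner (x - 2)
  have h7 : s.partner (x - 2) = x - 2 + 1 := by
    simp only [shift] at h2
    grind
  have := h.label_ne_zero hk hs (y := x - 2) (by omega) (by omega) h7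
  rwa [sub_add_cancel] at this

theorem IsRow.left_unique {r k : ℤ} {ε : ZMod 2} {s s' t : LabelledMatching} (hk : 1 ≤ k)
    (hkr : k ≤ r) (h : IsRow r k ε s t) (h' : IsRow r k ε s' t) (hs : s.IsStraight (r + 1))
    (hs' : s'.IsStraight (r + 1)) : s = s' := by
  have h1 := hs (r + 1) le_rfl
  have h2 := hs' (r + 1) le_rfl
  have hp : s.partner = s'.partner := by
    ext y
    have := s.partner_partner
    have := s'.partner_partner
    by_cases hy : y = r + 1
    · grind
    by_cases hy' : y = -r - 2
    · grind
    have h3 := h.partner_shift y hy hy'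
    rw [h'.partner_shift y hy hy'] at h3
    simp only [shift] at h3
    grind
  have hl : s.label = s'.label := by
    ext y
    have := s.label_partner
    have := s'.label_partner
    by_cases hy : y = r + 1
    · grind
    by_cases hy' : y = -r - 2
    · grind
    have h3 := h.label_shift y hy hy'
    rw [h'.label_shift y hy hy', hp] at h3
    exact (add_right_cancel h3).symm
  exact LabelledMatching.ext hp hl

theorem one_le_pos (j : ℕ) : 1 ≤ pos j := le_max_right _ _

theorem pos_le {j : ℕ} {r : ℕ} (hr : 1 ≤ r) (hj : j ≤ r) : pos j ≤ r := by
  unfold pos; omega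

theorem pos_of_pos {j : ℕ} (hj : 1 ≤ j) : pos j = j := by
  unfold pos; omega

theorem exists_reaches_descWord {r k : ℕ} (hk : 1 ≤ k) (hkr : k ≤ r) (η : ZMod 2)
    {s : LabelledMatching} (hs : s.IsStraight (r + 1)) :
    ∃ t, IsRow r k 0 s t ∧ Reaches η s (descWord r k) t := by
  induction hkr using Nat.decreasingInduction with
  | self =>
    refine ⟨_, isRow_join (by omega) 0 hs, ?_⟩
    have h1 := Reaches.concat (η := η) (s := s) r .nil (by
      rw [pos_of_pos hk]
      intro h
      have := s.partner_partner r
      have := (hs (r + 1) le_rfl).1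
      grind)
    simpa [descWord_self, pos_of_pos hk, lab, show r ≠ 0 by omega] using h1
  | of_succ k hkr ih =>
    obtain ⟨t, ht, hrt⟩ := ih (by omega)
    push_cast at ht
    refine ⟨_, ht.join (by omega) (by omega) 0 hs, ?_⟩
    have h1 := hrt.concat k (by
      rw [pos_of_pos hk]
      intro h
      have := t.partner_partner k
      have := ht.partner_eq
      grind)
    simpa [descWord_concat (show k ≤ r by omega), pos_of_pos hk, lab, show k ≠ 0 by omega] using h1

theorem exists_reaches_rowWord {r j : ℕ} (hr : 1 ≤ r) (hj : j ≤ r) (η : ZMod 2)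
    {s : LabelledMatching} (hs : s.IsStraight (r + 1)) :
    ∃ t, IsRow r (pos j) (lab η j) s t ∧ Reaches η s (rowWord r j) t := by
  rcases Nat.eq_zero_or_pos j with rfl | hj0
  · rw [rowWord_zero]
    rcases eq_or_lt_of_le hr with rfl | hr
    · refine ⟨_, isRow_join (by simp) (lab η 0) hs, ?_⟩
      rw [descWord_of_lt (by omega)]
      refine Reaches.nil.concat 0 fun h => ?_
      have := s.partner_partner 1
      have := (hs 2 (by norm_num)).1
      simp only [pos] at h
      grind
    · obtain ⟨t, ht, hrt⟩ := exists_reaches_descWord (k := 2) (by omega) hr η hs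
      refine ⟨_, IsRow.join (k := pos 0) (by simp [pos]) (by simp [pos]; omega) (lab η 0) hs ht,
        hrt.concat 0 fun h => ?_⟩
      have := t.partner_partner 1
      have := ht.partner_eq
      simp only [pos] at h
      grind
  · rw [rowWord_pos hj0, pos_of_pos hj0, lab, if_neg (by omega)]
    exact exists_reaches_descWord hj0 hj η hs

/-- The matching with vertical unlabelled arcs. -/
def vertical : LabelledMatching where
  partner x := -1 - x
  label _ := 0
  partner_partner x := by ring
  partner_ne x := by omega
  label_partner x := rfl

theorem vertical_isStraight (m : ℤ) : vertical.IsStraight m := fun _ _ => ⟨rfl, rfl⟩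

/-- The matching obtained from a list of rows, the last row coming first. -/
def IsState : List (ℕ × ℕ) → LabelledMatching → Prop
  | [], t => t = vertical
  | x :: l, t => ∃ s, IsState l s ∧ IsRow x.1 (pos x.2) (lab 1 x.2) s t

theorem IsState.properties {l : List (ℕ × ℕ)} (hl : IsNormal l) {t : LabelledMatching}
    (ht : IsState l t) : ∀ x ∈ l.head?, t.IsStraight (x.1 + 2) ∧ ¬ t.IsStraight (x.1 + 1) ∧
      t.partner (pos x.2) = pos x.2 + 1 ∧ t.label (pos x.2) = lab 1 x.2 ∧
      ∀ y, pos x.2 < y → t.partner y = y + 1 → t.label y ≠ 0 := by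
  induction l generalizing t with
  | nil => simp
  | cons x l ih =>
    obtain ⟨s, hs, hst⟩ := ht
    obtain ⟨hr, hj, hl, hx⟩ := hl
    have hk := one_le_pos x.2
    have hkr := pos_le hr hj
    have hstr : s.IsStraight (x.1 + 1) := by
      cases l with
      | nil => rw [IsState] at hs; exact hs ▸ vertical_isStraight _
      | cons y l =>
        have := (hx y (by simp)).1
        exact (ih hl hs y (by simp)).1.mono (by omega)
    have key : ∀ y, pos x.2 ≤ y → y < x.1 → s.partner y = y + 1 →
        s.label y + (if y = pos x.2 then lab 1 x.2 else 0) ≠ 0 := by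
      intro y hy _ hsy
      cases l with
      | nil => rw [IsState] at hs; subst hs; simp only [vertical] at hsy; omega
      | cons z l =>
        obtain ⟨-, -, hp, hlab, h4⟩ := ih hl hs z (by simp)
        have hc := (hx z (by simp)).2
        have h5 := h4 y
        simp only [pos, lab] at *
        grind
    rintro _ ⟨⟩
    exact ⟨hst.isStraight hk hkr hstr, hst.not_straight hk hkr hstr key, hst.partner_eq,
      hst.label_eq, fun y => hst.label_ne_zero_of_lt hk hkr hstr key⟩

theorem IsState.isStraight {l : List (ℕ × ℕ)} (hl : IsNormal l) {t : LabelledMatching}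
    (ht : IsState l t) {r : ℕ} (hr : ∀ x ∈ l.head?, x.1 < r) : t.IsStraight (r + 1) := by
  cases l with
  | nil => rw [IsState] at ht; exact ht ▸ vertical_isStraight _
  | cons y l =>
    have := hr y (by simp)
    exact (ht.properties hl y (by simp)).1.mono (by omega)

theorem IsState.left_unique {l l' : List (ℕ × ℕ)} (hl : IsNormal l) (hl' : IsNormal l')
    {t : LabelledMatching} (ht : IsState l t) (ht' : IsState l' t) : l = l' := by
  induction l generalizing l' t with
  | nil =>
    cases l' with
    | nil => rfl
    | cons x l' =>
      rw [IsState] at ht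
      exact absurd (ht ▸ vertical_isStraight _) (ht'.properties hl' x (by simp)).2.1
  | cons x l ih =>
    cases l' with
    | nil =>
      rw [IsState] at ht'
      exact absurd (ht' ▸ vertical_isStraight _) (ht.properties hl x (by simp)).2.1
    | cons x' l' =>
      obtain ⟨h1, h2, h3, h4, h5⟩ := ht.properties hl x (by simp)
      obtain ⟨h1', h2', h3', h4', h5'⟩ := ht'.properties hl' x' (by simp)
      have hr : x.1 = x'.1 := by
        rcases lt_trichotomy x.1 x'.1 with h | h | h
        · exact absurd (h1.mono (by omega)) h2'
        · exact h
        · exact absurd (h1'.mono (by omega)) h2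
      have hp : pos x.2 = pos x'.2 := by
        have h6 := h5 (pos x'.2)
        have h7 := h5' (pos x.2)
        simp only [pos, lab] at *
        grind
      have hj : x.2 = x'.2 := by
        rw [hp, h4'] at h4
        simp only [pos, lab] at hp h4
        grind
      obtain rfl : x = x' := Prod.ext hr hj
      obtain ⟨s, hs, hst⟩ := ht
      obtain ⟨s', hs', hst'⟩ := ht'
      obtain rfl := hst.left_unique (one_le_pos _) (pos_le hl.1 hl.2.1) hst'
        (hs.isStraight hl.2.2.1 fun y hy => (hl.2.2.2 y hy).1)
        (hs'.isStraight hl'.2.2.1 fun y hy => (hl'.2.2.2 y hy).1)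
      rw [ih hl.2.2.1 hl'.2.2.1 hs hs']

theorem exists_isState {l : List (ℕ × ℕ)} (hl : IsNormal l) :
    ∃ t, IsState l t ∧ Reaches 1 vertical (rowsWord l) t := by
  induction l with
  | nil => exact ⟨_, rfl, .nil⟩
  | cons x l ih =>
    obtain ⟨s, hs, h⟩ := ih hl.2.2.1
    obtain ⟨t, ht, h'⟩ := exists_reaches_rowWord hl.1 hl.2.1 1
      (hs.isStraight hl.2.2.1 fun y hy => (hl.2.2.2 y hy).1)
    exact ⟨t, ⟨s, hs, ht⟩, h.append h'⟩

end LabelledMatching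

namespace TLD

open LabelledMatching

variable {n : ℕ}

/-- The orbit map of the vertical matching. -/
def orbit (η : ZMod 2) (n : ℕ) : TLD n →ₗ[Polynomial ℤ] LabelledMatching →₀ Polynomial ℤ :=
  LinearMap.applyₗ (Finsupp.single vertical 1) ∘ₗ
    (MulOpposite.opLinearEquiv (Polynomial ℤ)).symm.toLinearMap ∘ₗ (rep η n).toLinearMap

theorem orbit_apply (η : ZMod 2) (x : TLD n) :
    orbit η n x = (rep η n x).unop (Finsupp.single vertical 1) := rfl

theorem orbit_wordProd {η : ZMod 2} {w : List ℕ} {t : LabelledMatching}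
    (h : Reaches η vertical w t) (hw : ∀ i ∈ w, i < n) :
    orbit η n (wordProd n w) = Finsupp.single t 1 := by
  induction h with
  | nil => simp [wordProd_nil, orbit_apply]
  | @concat w t i h hi ih =>
    have ih := ih fun j hj => hw j (by simp [hj])
    rw [orbit_apply] at ih ⊢
    rw [wordProd_append, wordProd_cons, wordProd_nil, mul_one, map_mul, rep_gen η (hw i (by simp)),
      MulOpposite.unop_mul, Module.End.mul_apply, ih, MulOpposite.unop_op, act, joinHom_single,
      weight, if_neg hi, one_smul]

theorem rep_one_fork (hn : 1 < n) {i : ℕ} (hi : 1 ≤ i) : rep 1 n (fork n i) = 0 := by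
  induction i, hi using Nat.le_induction with
  | base =>
    rw [fork_one, map_mul, rep_gen 1 hn, rep_gen 1 (by omega), ← MulOpposite.op_mul, act, act]
    exact congrArg _ (joinHom_mul_of_ne _ _ _ (by simp [lab]))
  | succ i hi ih => rw [fork_succ hi, map_mul, map_mul, ih, mul_zero, zero_mul]

theorem rep_zero_fork {i : ℕ} (hi : 1 ≤ i) (hin : i < n) :
    rep 0 n (fork n i) = (Polynomial.X : Polynomial ℤ) • rep 0 n (gen n i) := by
  induction i, hi using Nat.le_induction with
  | base =>
    have h : rep 0 n (gen n 0) = rep 0 n (gen n 1) := by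
      rw [rep_gen 0 hin, rep_gen 0 (by omega)]
      simp [act, lab, pos]
    rw [fork_one, map_mul, h, ← map_mul, gen_mul_self, map_smul]
  | succ i hi ih =>
    rw [fork_succ hi, map_mul, map_mul, ih (by omega), mul_smul_comm, smul_mul_assoc, ← map_mul,
      ← map_mul, gen_braid hin (by omega) (by unfold DAdj; omega)]

theorem orbit_one_forkProd (hn : 1 < n) {w : List ℕ} (hw : ∀ i ∈ w, 1 ≤ i) :
    orbit 1 n (forkProd n w) = 0 := by
  cases w with
  | nil => simp [forkProd]
  | cons i w => simp [forkProd_cons, orbit_apply, rep_one_fork hn (hw i (by simp))]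

theorem orbit_zero_forkProd {w : List ℕ} (hw : ∀ i ∈ w, 1 ≤ i ∧ i < n) (hne : w ≠ []) :
    orbit 0 n (forkProd n w) = (Polynomial.X : Polynomial ℤ) • orbit 0 n (wordProd n w) := by
  cases w with
  | nil => exact absurd rfl hne
  | cons i w =>
    have hi := hw i (by simp)
    rw [orbit_apply, forkProd_cons, map_mul, rep_zero_fork hi.1 hi.2, smul_mul_assoc, ← map_mul,
      ← wordProd_cons, ← map_smul, ← orbit_apply, map_smul]

end TLD

theorem mem_rowsWord {l : List (ℕ × ℕ)} {i : ℕ} (h : i ∈ rowsWord l) :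
    ∃ x ∈ l, i ∈ rowWord x.1 x.2 := by
  induction l with
  | nil => simp [rowsWord] at h
  | cons x l ih =>
    rcases List.mem_append.1 h with h | h
    · obtain ⟨y, hy, h⟩ := ih h
      exact ⟨y, by simp [hy], h⟩
    · exact ⟨x, by simp, h⟩

theorem mem_rowsWord_of_mem_normalForms {m n : ℕ} (hm : m ≤ 1) {l : List (ℕ × ℕ)}
    (hl : l ∈ normalForms m n) {i : ℕ} (hi : i ∈ rowsWord l) : m ≤ i ∧ i < n := by
  obtain ⟨x, hx, hi⟩ := mem_rowsWord hi
  have h := hl.2 x hx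
  refine ⟨?_, (le_of_mem_rowWord hi).trans_lt h.1⟩
  rcases Nat.eq_zero_or_pos m with rfl | hm0
  · omega
  · rw [rowWord_pos (by omega), mem_descWord] at hi
    omega

theorem LinearIndependent.sumElim_of_comp {R A M ι ι' : Type*} [CommRing R] [Ring A] [Algebra R A]
    [AddCommGroup M] [Module R M] {v : ι → A} {v' : ι' → A} (f g : A →ₗ[R] M)
    (hv : LinearIndependent R (f ∘ v)) (hv' : LinearIndependent R (g ∘ v'))
    (h : ∀ i, f (v' i) = 0) : LinearIndependent R (Sum.elim v v') := by
  refine LinearIndependent.sum_type hv.of_comp hv'.of_comp ?_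
  refine (Submodule.range_ker_disjoint hv).mono_right (Submodule.span_le.2 ?_)
  rintro _ ⟨i, rfl⟩
  exact h i

namespace TLD

open LabelledMatching

variable {n : ℕ}

theorem linearIndependent_family (hn : 1 < n) :
    LinearIndependent (Polynomial ℤ) (family n) := by
  choose st hst hreach using fun l : {l // IsNormal l} => exists_isState l.2
  have hinj : Function.Injective st := fun l l' h =>
    Subtype.ext ((hst l).left_unique l.2 l'.2 (h ▸ hst l'))
  have hbasis :=
    (Finsupp.basisSingleOne (R := Polynomial ℤ) (ι := LabelledMatching)).linearIndependent
  rw [Finsupp.coe_basisSingleOne] at hbasis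
  let v : normalForms 0 n → TLD n := fun l => wordProd n (rowsWord l)
  let v' : {l // l ∈ normalForms 1 n ∧ l ≠ []} → TLD n := fun l => forkProd n (rowsWord l)
  have hv : LinearIndependent (Polynomial ℤ) (orbit 1 n ∘ v) := by
    have h : orbit 1 n ∘ v = (fun t => Finsupp.single t 1) ∘ st ∘ fun l => ⟨l.1, l.2.1⟩ := by
      ext1 l
      exact orbit_wordProd (hreach ⟨l.1, l.2.1⟩) fun i hi =>
        (mem_rowsWord_of_mem_normalForms (by simp) l.2 hi).2
    rw [h]
    exact hbasis.comp _ (hinj.comp fun a b h => Subtype.ext (Subtype.mk.inj h))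
  have hv' : LinearIndependent (Polynomial ℤ) (orbit 0 n ∘ v') := by
    have h : orbit 0 n ∘ v' = fun l => (Polynomial.X : Polynomial ℤ) •
        ((fun t => Finsupp.single t (1 : Polynomial ℤ)) ∘ st ∘ fun l => ⟨l.1, l.2.1.1⟩) l := by
      ext1 l
      have hw := fun i hi => mem_rowsWord_of_mem_normalForms le_rfl l.2.1 (i := i) hi
      have hne : rowsWord l.1 ≠ [] := by
        obtain ⟨x, hx⟩ := List.exists_mem_of_ne_nil _ l.2.2
        exact List.ne_nil_of_mem (mem_rowsWord_of_mem_rowWord hx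
          (mem_rowWord_right (l.2.1.1.of_mem hx).2))
      have h0 : 0 ∉ rowsWord l.1 := fun h => by simpa using (hw 0 h).1
      refine (orbit_zero_forkProd hw hne).trans ?_
      rw [orbit_wordProd ((hreach ⟨l.1, l.2.1.1⟩).of_zero_notMem h0) fun i hi => (hw i hi).2]
      rfl
    rw [h]
    refine LinearIndependent.map' (hbasis.comp _ (hinj.comp fun a b h =>
      Subtype.ext (Subtype.mk.inj h))) (LinearMap.lsmul (Polynomial ℤ) _ Polynomial.X) ?_
    exact LinearMap.ker_eq_bot.2 (smul_right_injective _ Polynomial.X_ne_zero)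
  exact LinearIndependent.sumElim_of_comp (orbit 1 n) (orbit 0 n) hv hv' fun l =>
    orbit_one_forkProd hn fun i hi => (mem_rowsWord_of_mem_normalForms le_rfl l.2.1 hi).1

end TLD

section Counting

open Finset Classical

/-- The lists of rows that can be followed by a row ending in `j`. -/
def FollowedBy (j : ℕ) (l : List (ℕ × ℕ)) : Prop := ∀ y ∈ l.head?, y.2 < j ∨ (y.2 = 1 ∧ j = 0)

/-- The finite set of normal forms with rows at most `k` whose ends are at least `m`. -/
def normalFinset (m : ℕ) : ℕ → Finset (List (ℕ × ℕ))
  | 0 => {[]}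
  | k + 1 => normalFinset m k ∪ (Icc m (k + 1)).biUnion fun j =>
      ((normalFinset m k).filter (FollowedBy j)).image ((k + 1, j) :: ·)

theorem mem_normalFinset {m k : ℕ} {l : List (ℕ × ℕ)} :
    l ∈ normalFinset m k ↔ l ∈ normalForms m (k + 1) := by
  induction k generalizing l with
  | zero =>
    rw [normalFinset, mem_singleton]
    refine ⟨fun h => h ▸ ⟨trivial, by simp⟩,
      fun h => List.eq_nil_iff_forall_not_mem.2 fun x hx => ?_⟩
    have := (h.1.of_mem hx).1
    have := (h.2 x hx).1
    omega
  | succ k ih =>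
    simp only [normalFinset, mem_union, mem_biUnion, mem_image, mem_filter, mem_Icc, ih]
    constructor
    · rintro (h | ⟨j, hj, l, ⟨hl, hlj⟩, rfl⟩)
      · exact ⟨h.1, fun x hx => ⟨(h.2 x hx).1.trans (by omega), (h.2 x hx).2⟩⟩
      · refine ⟨⟨by simp, hj.2, hl.1, fun y hy =>
          ⟨(hl.2 y (List.mem_of_mem_head? hy)).1, hlj y hy⟩⟩, fun x hx => ?_⟩
        rcases List.mem_cons.1 hx with rfl | hx
        · exact ⟨by simp, hj.1⟩
        · exact ⟨(hl.2 x hx).1.trans (by omega), (hl.2 x hx).2⟩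
    · intro h
      cases l with
      | nil => exact .inl ⟨trivial, by simp⟩
      | cons x l =>
        have hx := h.2 x (by simp)
        by_cases hxk : x.1 < k + 1
        · refine .inl ⟨h.1, fun y hy => ⟨?_, (h.2 y hy).2⟩⟩
          rcases List.mem_cons.1 hy with rfl | hy
          · exact hxk
          · exact (h.1.fst_lt hy).trans hxk
        · have hxe : x.1 = k + 1 := by omega
          refine .inr ⟨x.2, ⟨hx.2, hxe ▸ h.1.2.1⟩, l, ⟨⟨h.1.2.2.1, fun y hy => ⟨?_, ?_⟩⟩,
            fun y hy => (h.1.2.2.2 y hy).2⟩, ?_⟩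
          · exact hxe ▸ h.1.fst_lt hy
          · exact (h.2 y (by simp [hy])).2
          · rw [← hxe]

/-- The number of normal forms whose last row ends in `j`. -/
def endCount (m k j : ℕ) : ℕ := #{l ∈ normalFinset m k | ∃ y ∈ l.head?, y.2 = j}

/-- The number of normal forms whose last row, if it exists, ends below `j`. -/
def belowCount (m k j : ℕ) : ℕ := #{l ∈ normalFinset m k | ∀ y ∈ l.head?, y.2 < j}

theorem nil_mem_normalFinset (m k : ℕ) : [] ∈ normalFinset m k :=
  mem_normalFinset.2 ⟨trivial, by simp⟩

theorem belowCount_zero (m k : ℕ) : belowCount m k 0 = 1 := by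
  rw [belowCount, card_eq_one]
  refine ⟨[], ?_⟩
  ext l
  rw [mem_filter, mem_singleton]
  constructor
  · rintro ⟨-, h⟩
    cases l with
    | nil => rfl
    | cons x l => simpa using h x (by simp)
  · rintro rfl
    exact ⟨nil_mem_normalFinset m k, by simp⟩

theorem belowCount_succ (m k j : ℕ) :
    belowCount m k (j + 1) = belowCount m k j + endCount m k j := by
  rw [belowCount, belowCount, endCount, ← card_union_of_disjoint, ← filter_or]
  · congr 1
    refine filter_congr fun l _ => ?_
    cases l with
    | nil => simp
    | cons x l => simp; omega
  · refine disjoint_filter.2 fun l _ h => ?_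
    cases l with
    | nil => simp
    | cons x l => simp at h ⊢; omega

theorem card_filter_followedBy {m k j : ℕ} (hj : 1 ≤ j) :
    #{l ∈ normalFinset m k | FollowedBy j l} = belowCount m k j := by
  rw [belowCount]
  congr 1
  refine filter_congr fun l _ => ?_
  simp [FollowedBy, show j ≠ 0 by omega]

theorem card_filter_followedBy_zero (m k : ℕ) :
    #{l ∈ normalFinset m k | FollowedBy 0 l} = 1 + endCount m k 1 := by
  suffices h : _ = belowCount m k 0 + endCount m k 1 by rwa [belowCount_zero] at h
  rw [belowCount, endCount, ← card_union_of_disjoint, ← filter_or]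
  · congr 1
    refine filter_congr fun l _ => ?_
    cases l with
    | nil => simp [FollowedBy]
    | cons x l => simp [FollowedBy]
  · refine disjoint_filter.2 fun l _ h => ?_
    cases l with
    | nil => simp
    | cons x l => simp at h

theorem endCount_succ (m k j : ℕ) : endCount m (k + 1) j = endCount m k j +
    if m ≤ j ∧ j ≤ k + 1 then #{l ∈ normalFinset m k | FollowedBy j l} else 0 := by
  have h : ({l ∈ normalFinset m (k + 1) | ∃ y ∈ l.head?, y.2 = j} : Finset _) =
      {l ∈ normalFinset m k | ∃ y ∈ l.head?, y.2 = j} ∪ if m ≤ j ∧ j ≤ k + 1 then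
        ((normalFinset m k).filter (FollowedBy j)).image ((k + 1, j) :: ·) else ∅ := by
    ext l
    simp only [normalFinset, mem_filter, mem_union, mem_biUnion, mem_Icc, or_and_right]
    refine or_congr_right ?_
    split_ifs with hj
    · constructor
      · rintro ⟨⟨i, hi, hl⟩, y, hy, rfl⟩
        obtain ⟨s, hs, rfl⟩ := mem_image.1 hl
        obtain rfl : (k + 1, i) = y := by simpa using hy
        exact hl
      · intro hl
        refine ⟨⟨j, hj, hl⟩, ?_⟩
        obtain ⟨s, hs, rfl⟩ := mem_image.1 hl
        exact ⟨_, rfl, rfl⟩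
    · simp only [notMem_empty, iff_false]
      rintro ⟨⟨i, hi, hl⟩, y, hy, rfl⟩
      obtain ⟨s, hs, rfl⟩ := mem_image.1 hl
      obtain rfl : (k + 1, i) = y := by simpa using hy
      exact hj hi
  rw [endCount, h, card_union_of_disjoint, ← endCount]
  · split_ifs with hj
    · rw [card_image_of_injective _ (List.cons_injective)]
    · rfl
  · split_ifs with hj
    · refine disjoint_left.2 fun l hl hl' => ?_
      obtain ⟨s, -, rfl⟩ := mem_image.1 hl'
      have := ((mem_normalFinset.1 (mem_filter.1 hl).1).2 (k + 1, j) (by simp)).1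
      simp at this
    · exact disjoint_empty_right _

theorem belowCount_succ_succ {m k j : ℕ} (hj : 1 ≤ j) (hm : m ≤ j) (hk : j ≤ k + 1) :
    belowCount m (k + 1) (j + 1) = belowCount m (k + 1) j + belowCount m k (j + 1) := by
  rw [belowCount_succ, endCount_succ, if_pos ⟨hm, hk⟩, card_filter_followedBy hj,
    belowCount_succ m k]
  ring

theorem endCount_eq_zero {m k j : ℕ} (h : j < m ∨ k < j) : endCount m k j = 0 := by
  rw [endCount, card_eq_zero, filter_eq_empty_iff]
  rintro l hl ⟨y, hy, rfl⟩
  have h1 := mem_normalFinset.1 hl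
  have h2 := h1.2 y (List.mem_of_mem_head? hy)
  have h3 := h1.1.of_mem (List.mem_of_mem_head? hy)
  omega

theorem card_normalFinset (m k : ℕ) : #(normalFinset m k) = belowCount m k (k + 1) := by
  rw [belowCount, filter_true_of_mem]
  intro l hl y hy
  have h1 := mem_normalFinset.1 hl
  have h2 := h1.2 y (List.mem_of_mem_head? hy)
  have h3 := h1.1.of_mem (List.mem_of_mem_head? hy)
  omega

theorem belowCount_one (k : ℕ) : belowCount 1 k 1 = 1 := by
  rw [belowCount_succ, belowCount_zero, endCount_eq_zero (by simp)]

theorem belowCount_one_add_choose {k i : ℕ} (hi : i ≤ k) :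
    belowCount 1 k (i + 2) + (k + i + 2).choose i = (k + i + 2).choose (i + 1) := by
  have hlast : ∀ k, belowCount 1 (k + 1) (k + 2) + (2 * k + 3).choose k =
      (2 * k + 3).choose (k + 1) → belowCount 1 (k + 1) (k + 3) + (2 * k + 4).choose (k + 1) =
        (2 * k + 4).choose (k + 2) := by
    intro k h
    rw [belowCount_succ, endCount_eq_zero (by simp), Nat.choose_succ_succ' (2 * k + 3) k,
      Nat.choose_succ_succ' (2 * k + 3) (k + 1)]
    have := Nat.choose_symm_of_eq_add (show 2 * k + 3 = k + 1 + (k + 2) by ring)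
    simp only [add_assoc, Nat.reduceAdd] at *
    omega
  induction k generalizing i with
  | zero =>
    obtain rfl : i = 0 := by omega
    rw [belowCount_succ, belowCount_one, endCount_eq_zero (by simp)]
    simp
  | succ k ih =>
    induction i with
    | zero =>
      have := ih (i := 0) (by omega)
      rw [belowCount_succ_succ le_rfl le_rfl (by omega), belowCount_one]
      simp at *
      omega
    | succ i ihi =>
      have h1 : belowCount 1 (k + 1) (i + 2) + (k + i + 3).choose i =
          (k + i + 3).choose (i + 1) := by
        simpa only [show k + 1 + i + 2 = k + i + 3 by ring] using ihi (by omega)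
      rw [show k + 1 + (i + 1) + 2 = k + i + 3 + 1 by ring]
      rcases Nat.lt_or_ge i k with hik | hik
      · have h2 : belowCount 1 k (i + 3) + (k + i + 3).choose (i + 1) =
            (k + i + 3).choose (i + 2) := by
          simpa only [show k + (i + 1) + 2 = k + i + 3 by ring] using ih (i := i + 1) (by omega)
        have h3 : belowCount 1 (k + 1) (i + 3) = belowCount 1 (k + 1) (i + 2) +
          belowCount 1 k (i + 3) := belowCount_succ_succ (by omega) (by omega) (by omega)
        have h4 := Nat.choose_succ_succ' (k + i + 3) i
        have h5 : (k + i + 3 + 1).choose (i + 2) = (k + i + 3).choose (i + 1) +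
          (k + i + 3).choose (i + 2) := Nat.choose_succ_succ' (k + i + 3) (i + 1)
        rw [show i + 1 + 2 = i + 3 by ring, show i + 1 + 1 = i + 2 by ring]
        omega
      · obtain rfl : i = k := by omega
        rw [← two_mul] at h1 ⊢
        exact hlast i h1

theorem sum_choose_succ (N a : ℕ) : ∑ t ∈ range (a + 1), (N + 1).choose t =
    ∑ t ∈ range (a + 1), N.choose t + ∑ t ∈ range a, N.choose t := by
  rw [sum_range_succ', sum_range_succ' _ a]
  simp only [Nat.choose_succ_succ', sum_add_distrib, Nat.choose_zero_right]
  ring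

theorem belowCount_zero_two (k : ℕ) : belowCount 0 k 2 + 1 = 2 ^ (k + 1) := by
  induction k with
  | zero =>
    have h : endCount 0 0 0 = 0 := by simp [endCount, normalFinset]
    rw [belowCount_succ, belowCount_succ, belowCount_zero, h, endCount_eq_zero (by simp)]
    rfl
  | succ k ih =>
    rw [belowCount_succ_succ le_rfl (by omega) (by omega), belowCount_succ, belowCount_zero,
      endCount_succ, if_pos (by simp), card_filter_followedBy_zero]
    have h1 := belowCount_succ 0 k 1
    have h2 := belowCount_succ 0 k 0
    rw [belowCount_zero] at h2
    rw [pow_succ]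
    simp at *
    omega

theorem belowCount_zero_add_sum {k i : ℕ} (hi : i ≤ k) :
    belowCount 0 k (i + 2) + ∑ t ∈ range i, (k + i + 1).choose t =
      ∑ t ∈ range (k + 1), (k + i + 1).choose t := by
  have hzero : ∀ k, belowCount 0 k 2 = ∑ t ∈ range (k + 1), (k + 1).choose t := by
    intro k
    have h1 := belowCount_zero_two k
    have h2 := Nat.sum_range_choose (k + 1)
    rw [sum_range_succ, Nat.choose_self] at h2
    omega
  induction k generalizing i with
  | zero =>
    obtain rfl : i = 0 := by omega
    simpa using hzero 0
  | succ k ih =>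
    induction i with
    | zero => simpa using hzero (k + 1)
    | succ i ihi =>
      have h1 : belowCount 0 (k + 1) (i + 2) + ∑ t ∈ range i, (k + i + 2).choose t =
          ∑ t ∈ range (k + 2), (k + i + 2).choose t := by
        simpa only [show k + 1 + i + 1 = k + i + 2 by ring] using ihi (by omega)
      have h2 := sum_choose_succ (k + i + 2) i
      have h3 : ∑ t ∈ range (k + 2), (k + i + 2 + 1).choose t =
        ∑ t ∈ range (k + 2), (k + i + 2).choose t + ∑ t ∈ range (k + 1), (k + i + 2).choose t :=
        sum_choose_succ (k + i + 2) (k + 1)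
      rw [show k + 1 + (i + 1) + 1 = k + i + 2 + 1 by ring, show i + 1 + 2 = i + 3 by ring,
        show k + 1 + 1 = k + 2 by ring]
      rcases Nat.lt_or_ge i k with hik | hik
      · have h4 : belowCount 0 k (i + 3) + ∑ t ∈ range (i + 1), (k + i + 2).choose t =
            ∑ t ∈ range (k + 1), (k + i + 2).choose t := by
          simpa only [show k + (i + 1) + 1 = k + i + 2 by ring] using ih (i := i + 1) (by omega)
        have h5 : belowCount 0 (k + 1) (i + 3) = belowCount 0 (k + 1) (i + 2) +
          belowCount 0 k (i + 3) := belowCount_succ_succ (by omega) (by omega) (by omega)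
        omega
      · obtain rfl : i = k := by omega
        have h4 : belowCount 0 (i + 1) (i + 3) = belowCount 0 (i + 1) (i + 2) := by
          rw [belowCount_succ, endCount_eq_zero (by simp), add_zero]
        omega

theorem card_normalFinset_zero (k : ℕ) : #(normalFinset 0 k) = (2 * k + 1).choose k := by
  have h := belowCount_zero_add_sum (le_refl k)
  rw [sum_range_succ, add_comm, add_left_cancel_iff, belowCount_succ, endCount_eq_zero (by simp),
    ← two_mul] at h
  rw [card_normalFinset, ← h, add_zero]

theorem two_mul_choose_eq (k : ℕ) : 2 * (2 * k + 1).choose k = (k + 2) * catalan (k + 1) := by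
  rw [succ_mul_catalan_eq_centralBinom, Nat.centralBinom,
    show 2 * (k + 1) = 2 * k + 1 + 1 by ring, Nat.choose_succ_succ',
    Nat.choose_symm_of_eq_add (show 2 * k + 1 = k + (k + 1) by ring)]
  ring

theorem card_normalFinset_one (k : ℕ) : #(normalFinset 1 k) = catalan (k + 1) := by
  have h := belowCount_one_add_choose (le_refl k)
  rw [belowCount_succ, endCount_eq_zero (by simp), add_zero, ← card_normalFinset, ← two_mul] at h
  have h2 := Nat.choose_succ_right_eq (2 * k + 2) k
  have h3 := succ_mul_catalan_eq_centralBinom (k + 1)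
  rw [Nat.centralBinom, mul_add, mul_one] at h3
  rw [show 2 * k + 2 - k = k + 2 by omega] at h2
  have h4 : (k + 2) * #(normalFinset 1 k) = (k + 2) * catalan (k + 1) := by
    nlinarith
  exact Nat.eq_of_mul_eq_mul_left (by omega) h4

end Counting

/-- **(Fan)** For `n ≥ 4`, the Temperley–Lieb algebra `TL(Dₙ)` is a free `ℤ[δ]`-module of
rank `((n + 3)·C(n) − 2)/2 = ((n + 3)/2)·C(n) − 1`, where `C(n)` is the `n`-th Catalan
number. -/
theorem TLD_rank (n : ℕ) (hn : 4 ≤ n) :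
    Module.Free (Polynomial ℤ) (TLD n) ∧
    Module.rank (Polynomial ℤ) (TLD n) = (((n + 3) * catalan n - 2) / 2 : ℕ) := by
  let b := Module.Basis.mk (TLD.linearIndependent_family (n := n) (by omega))
    (TLD.span_range_family (n := n) (by omega)).ge
  refine ⟨Module.Free.of_basis b, ?_⟩
  obtain ⟨k, rfl⟩ : ∃ k, n = k + 1 := ⟨n - 1, by omega⟩
  have h0 : Cardinal.mk (normalForms 0 (k + 1)) = (2 * k + 1).choose k := by
    have : normalForms 0 (k + 1) = (normalFinset 0 k : Set (List (ℕ × ℕ))) := by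
      ext l
      exact mem_normalFinset.symm
    rw [this, ← card_normalFinset_zero]
    exact Cardinal.mk_coe_finset
  have h1 : Cardinal.mk {l // l ∈ normalForms 1 (k + 1) ∧ l ≠ []} = (catalan (k + 1) - 1 : ℕ) := by
    classical
    have : (fun l => l ∈ normalForms 1 (k + 1) ∧ l ≠ []) =
        (· ∈ (normalFinset 1 k).erase []) := by
      ext l
      rw [Finset.mem_erase, mem_normalFinset, and_comm]
    rw [this, ← card_normalFinset_one, ← Finset.card_erase_of_mem (nil_mem_normalFinset 1 k)]
    exact Cardinal.mk_coe_finset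
  rw [← b.mk_eq_rank'', Cardinal.mk_sum, Cardinal.lift_id, Cardinal.lift_id, h0, h1, ← Nat.cast_add]
  congr 1
  have h2 := two_mul_choose_eq k
  have h3 : 0 < catalan (k + 1) := by
    rw [← card_normalFinset_one]
    exact Finset.card_pos.2 ⟨_, nil_mem_normalFinset 1 k⟩
  have h4 : (k + 1 + 3) * catalan (k + 1) = (k + 2) * catalan (k + 1) + 2 * catalan (k + 1) := by
    ring
  omega

end
end
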